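/- arXiv:1810.13011 — 11 statements merged into one kernel-verified Lean document; each statement's English description precedes it below -/
import Mathlib

section
/- Let N ≥ 2 be an integer and A > 2 a real number. Define f on configurations q = (q_0,…,q_{N−1}) of N distinct points in ℝ² (equal masses m_k = 1, total mass N) by f(q) = (N/2)·∑_{k=0}^{N−1} |q_k|² + (1/(A−2))·∑_{0≤k<l≤N−1} |q_k − q_l|^{2−A}. For r > 0 let q(r) be the regular N-gon configuration q_k = r·(cos(2πk/N), sin(2πk/N)). Then q(r) is a critical point of f (i.e. the gradient of f vanishes at q(r)) if and only if r^A = (∑_{j=1}^{N−1} (2 sin(πj/N))^{2−A})/(2N). -/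
open Real Finset

lemma aux_rpow_deriv {N : ℕ} (A : ℝ) (hA : 2 < A) (q : Fin N → ℂ) (k l : Fin N) (h : q k ≠ q l) :
    HasFDerivAt (fun q : Fin N → ℂ => ‖q k - q l‖ ^ (2 - A))
      (((2 - A) * ‖q k - q l‖ ^ (-A)) • ((innerSL ℝ (q k - q l)).comp
        ((ContinuousLinearMap.proj (R := ℝ) (φ := fun _ : Fin N => ℂ) k) - ContinuousLinearMap.proj (R := ℝ) (φ := fun _ : Fin N => ℂ) l))) q := by
  have e : (fun q : Fin N → ℂ => ‖q k - q l‖ ^ (2 - A))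
      = fun q : Fin N → ℂ => (‖q k - q l‖ ^ 2) ^ ((2 - A) / 2) := by
    funext q
    rw [← Real.rpow_natCast, ← Real.rpow_mul (norm_nonneg _)]
    congr 1; push_cast; ring
  rw [e]
  have hpos : 0 < ‖q k - q l‖ := norm_pos_iff.2 (sub_ne_zero.2 h)
  have h1 : HasFDerivAt (fun q : Fin N → ℂ => q k - q l)
      ((ContinuousLinearMap.proj (R := ℝ) (φ := fun _ : Fin N => ℂ) k) - ContinuousLinearMap.proj (R := ℝ) (φ := fun _ : Fin N => ℂ) l) q :=
    ((ContinuousLinearMap.proj (R := ℝ) (φ := fun _ : Fin N => ℂ) k) - ContinuousLinearMap.proj (R := ℝ) (φ := fun _ : Fin N => ℂ) l).hasFDerivAt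
  have h2 := h1.norm_sq.rpow_const (p := (2 - A) / 2) (Or.inl (by positivity))
  refine h2.congr_fderiv ?_
  ext v
  have e2 : (‖q k - q l‖ ^ 2) ^ ((2 - A) / 2 - 1) = ‖q k - q l‖ ^ (-A) := by
    rw [← Real.rpow_natCast, ← Real.rpow_mul (norm_nonneg _)]
    congr 1; push_cast; ring
  rw [e2]
  simp
  ring

lemma aux_sym {N : ℕ} (G : Fin N → Fin N → ℝ) (hs : ∀ k l, G k l = G l k) (h0 : ∀ k, G k k = 0) :
    ∑ k, ∑ l, G k l = 2 * ∑ k, ∑ l ∈ Finset.Ioi k, G k l := by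
  have a : ∀ k, ∑ l, G k l = ∑ l ∈ Finset.Ioi k, G k l + ∑ l ∈ Finset.Iio k, G k l := by
    intro k
    have e : (Finset.univ : Finset (Fin N)) = insert k (Finset.Ioi k ∪ Finset.Iio k) := by
      ext x; simp; grind
    rw [e, Finset.sum_insert (by simp), Finset.sum_union, h0, zero_add]
    rw [Finset.disjoint_left]; intro x; simp; grind
  simp_rw [a]
  rw [Finset.sum_add_distrib, two_mul]
  congr 1
  rw [Finset.sum_comm' (t' := Finset.univ) (s' := fun k => Finset.Ioi k) (by simp)]
  exact Finset.sum_congr rfl fun k _ => Finset.sum_congr rfl fun l _ => hs _ _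

lemma aux_sum (N : ℕ) (hN : 2 ≤ N) (A : ℝ) (r : ℝ) (hr : 0 < r)
    (q : Fin N → ℂ)
    (hq : ∀ k : Fin N, q k = (r : ℂ) *
      Complex.exp (((2 * π * (k : ℕ) / N : ℝ) : ℂ) * Complex.I)) (k : Fin N) :
    ∑ l, ((‖q k - q l‖ ^ (-A) : ℝ) : ℂ) * (q k - q l) =
      ((r ^ (-A) * ((∑ j ∈ Finset.Icc 1 (N - 1), (2 * Real.sin (π * j / N)) ^ (2 - A)) / 2) : ℝ) : ℂ)
        * q k := by
  haveI : NeZero N := ⟨by omega⟩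
  have hN0 : (N : ℂ) ≠ 0 := by exact_mod_cast (NeZero.ne N)
  have hN0' : (N : ℝ) ≠ 0 := by exact_mod_cast (NeZero.ne N)
  set ω : ℂ := Complex.exp (2 * π * Complex.I / N) with hω
  have hωN : ω ^ N = 1 := by
    rw [hω, ← Complex.exp_nat_mul, mul_div_cancel₀ _ hN0, Complex.exp_two_pi_mul_I]
  have he : ∀ j : ℕ, Complex.exp (((2 * π * (j : ℕ) / N : ℝ) : ℂ) * Complex.I) = ω ^ j := by
    intro j
    rw [hω, ← Complex.exp_nat_mul]; congr 1; push_cast; ring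
  have hn : ∀ j : ℕ, ‖ω ^ j‖ = 1 := by
    intro j; rw [← he, Complex.norm_exp_ofReal_mul_I]
  have hadd : ∀ a b : Fin N, ω ^ ((a + b : Fin N) : ℕ) = ω ^ (a : ℕ) * ω ^ (b : ℕ) := by
    intro a b
    rw [Fin.val_add, ← pow_add]
    conv_rhs => rw [← Nat.mod_add_div (a + b : ℕ) N, pow_add, pow_mul, hωN, one_pow, mul_one]
  have hneg : ∀ a : Fin N, ω ^ ((-a : Fin N) : ℕ) = (starRingEnd ℂ) (ω ^ (a : ℕ)) := by
    intro a
    have h1 := hadd a (-a)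
    rw [add_neg_cancel, Fin.val_zero, pow_zero] at h1
    have h2 : ω ^ (a : ℕ) * (starRingEnd ℂ) (ω ^ (a : ℕ)) = 1 := by
      rw [Complex.mul_conj, Complex.normSq_eq_norm_sq, hn]; simp
    have h3 : ω ^ (a : ℕ) ≠ 0 := by
      intro h; have := hn a; rw [h] at this; simp at this
    exact mul_left_cancel₀ h3 (h1.symm.trans h2.symm)
  have hq' : ∀ k : Fin N, q k = r * ω ^ (k : ℕ) := fun k => by rw [hq, he]
  set T : ℂ := ∑ j : Fin N, ((‖1 - ω ^ (j : ℕ)‖ ^ (-A) : ℝ) : ℂ) * (1 - ω ^ (j : ℕ)) with hT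
  have hmain : ∑ l, ((‖q k - q l‖ ^ (-A) : ℝ) : ℂ) * (q k - q l) = ((r ^ (-A) : ℝ) : ℂ) * T * q k := by
    rw [← Equiv.sum_comp (Equiv.addLeft k), hT, Finset.mul_sum, Finset.sum_mul]
    refine Finset.sum_congr rfl fun j _ => ?_
    have e : q k - q (k + j) = q k * (1 - ω ^ (j : ℕ)) := by
      rw [hq', hq', hadd]; ring
    have e2 : ‖q k‖ = r := by
      rw [hq', norm_mul, hn]; simp [hr.le]
    rw [Equiv.coe_addLeft, e, norm_mul, e2, Real.mul_rpow hr.le (norm_nonneg _)]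
    push_cast; ring
  have hnorm : ∀ j : ℕ, j < N → ‖1 - ω ^ j‖ = 2 * Real.sin (π * j / N) := by
    intro j hj
    have hs : 0 ≤ Real.sin (π * j / N) := by
      apply Real.sin_nonneg_of_nonneg_of_le_pi (by positivity)
      rw [div_le_iff₀ (by positivity)]
      exact mul_le_mul_of_nonneg_left (by exact_mod_cast hj.le) pi_pos.le
    rw [← sq_eq_sq₀ (norm_nonneg _) (by positivity), ← he, ← Complex.normSq_eq_norm_sq,
      Complex.normSq_apply]
    have e : 2 * π * (j : ℕ) / N = 2 * (π * j / N) := by ring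
    rw [e, Complex.sub_re, Complex.sub_im, Complex.exp_ofReal_mul_I_re, Complex.exp_ofReal_mul_I_im,
      Real.cos_two_mul, Real.sin_two_mul]
    simp only [Complex.one_re, Complex.one_im]
    have := Real.sin_sq_add_cos_sq (π * j / N)
    have hc : Real.cos (π * j / N) ^ 2 = 1 - Real.sin (π * j / N) ^ 2 := by linarith
    ring_nf at hc ⊢
    grind
  have hTT : T + T = ((∑ j ∈ Finset.Icc 1 (N - 1), (2 * Real.sin (π * j / N)) ^ (2 - A) : ℝ) : ℂ) := by
    have hT2 : T = ∑ j : Fin N, ((‖1 - ω ^ (j : ℕ)‖ ^ (-A) : ℝ) : ℂ) * (1 - (starRingEnd ℂ) (ω ^ (j : ℕ))) := by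
      rw [hT, ← Equiv.sum_comp (Equiv.neg (Fin N))]
      refine Finset.sum_congr rfl fun j _ => ?_
      rw [Equiv.neg_apply, hneg]
      congr 3
      rw [← Complex.norm_conj (1 - ω ^ (j:ℕ)), map_sub, map_one]
    have h3 : T + T = ∑ j : Fin N, ((‖1 - ω ^ (j : ℕ)‖ ^ (-A) * ‖1 - ω ^ (j : ℕ)‖ ^ 2 : ℝ) : ℂ) := by
      conv_lhs => rw [hT2]; arg 1; rw [← hT2, hT]
      rw [← Finset.sum_add_distrib]
      refine Finset.sum_congr rfl fun j _ => ?_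
      rw [← mul_add, Complex.ofReal_mul, ← Complex.normSq_eq_norm_sq, ← Complex.mul_conj, map_sub, map_one]
      have h2 : ω ^ (j : ℕ) * (starRingEnd ℂ) (ω ^ (j : ℕ)) = 1 := by
        rw [Complex.mul_conj, Complex.normSq_eq_norm_sq, hn]; simp
      congr 1
      linear_combination -h2
    rw [h3, ← Complex.ofReal_sum]
    congr 1
    rw [Fin.sum_univ_eq_sum_range (fun j => ‖1 - ω ^ j‖ ^ (-A) * ‖1 - ω ^ j‖ ^ 2) N]
    have e : Finset.range N = insert 0 (Finset.Icc 1 (N - 1)) := by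
      ext x; simp; omega
    rw [e, Finset.sum_insert (by simp)]
    simp only [pow_zero, sub_self, norm_zero, ne_eq, OfNat.ofNat_ne_zero, not_false_eq_true,
      zero_pow, mul_zero, zero_add]
    refine Finset.sum_congr rfl fun j hj => ?_
    rw [Finset.mem_Icc] at hj
    have hs : 0 < Real.sin (π * j / N) := by
      have : (0:ℝ) < j := by exact_mod_cast hj.1
      have hjN : (j : ℝ) < N := by exact_mod_cast (by omega : j < N)
      apply Real.sin_pos_of_pos_of_lt_pi (by positivity)
      rw [div_lt_iff₀ (by positivity)]
      exact mul_lt_mul_of_pos_left hjN pi_pos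
    rw [hnorm j (by omega), ← Real.rpow_natCast, ← Real.rpow_add (by positivity)]
    congr 1; push_cast; ring
  rw [hmain]
  push_cast at hTT ⊢
  rw [← hTT]; ring

/-- For `N ≥ 2` and `A > 2`, the regular `N`-gon of radius `r > 0` (equal unit
masses) is a critical point of `f = (N/2)·∑‖q_k‖² + (1/(A-2))·∑_{k<l} ‖q_k - q_l‖^(2-A)`
if and only if `r^A = (∑_{j=1}^{N-1} (2 sin(πj/N))^(2-A)) / (2N)`. The plane `ℝ²` is
modeled by `ℂ` with its Euclidean norm. -/
theorem regular_polygon_critical_iff_radius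
    (N : ℕ) (hN : 2 ≤ N) (A : ℝ) (hA : 2 < A)
    (f : (Fin N → ℂ) → ℝ)
    (hf : ∀ q : Fin N → ℂ, (∀ k l, k ≠ l → q k ≠ q l) →
      f q = (N / 2 : ℝ) * ∑ k, ‖q k‖ ^ 2 +
        (1 / (A - 2)) * ∑ k, ∑ l ∈ Finset.Ioi k, ‖q k - q l‖ ^ (2 - A))
    (r : ℝ) (hr : 0 < r)
    (q : Fin N → ℂ)
    (hq : ∀ k : Fin N, q k = (r : ℂ) *
      Complex.exp (((2 * π * (k : ℕ) / N : ℝ) : ℂ) * Complex.I)) :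
    fderiv ℝ f q = 0 ↔
      r ^ A = (∑ j ∈ Finset.Icc 1 (N - 1), (2 * Real.sin (π * j / N)) ^ (2 - A)) / (2 * N) := by
  have hN0 : N ≠ 0 := by omega
  have hN0' : (0 : ℝ) < N := by exact_mod_cast (by omega : 0 < N)
  have hsum := aux_sum N hN A r hr q hq
  set S := ∑ j ∈ Finset.Icc 1 (N - 1), (2 * Real.sin (π * j / N)) ^ (2 - A) with hS
  have hdist : ∀ k l, k ≠ l → q k ≠ q l := by
    have hprim := Complex.isPrimitiveRoot_exp N hN0
    intro k l hkl h
    apply hkl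
    have he : ∀ j : ℕ, Complex.exp (((2 * π * (j : ℕ) / N : ℝ) : ℂ) * Complex.I)
        = Complex.exp (2 * π * Complex.I / N) ^ j := by
      intro j
      rw [← Complex.exp_nat_mul]; congr 1; push_cast; ring
    rw [hq, hq, he, he] at h
    have h' := mul_left_cancel₀ (by exact_mod_cast hr.ne') h
    exact Fin.ext (hprim.pow_inj k.2 l.2 h')
  have hopen : ∀ᶠ p in nhds q, ∀ k l, k ≠ l → p k ≠ p l := by
    rw [Filter.eventually_all]; intro k
    rw [Filter.eventually_all]; intro l
    by_cases hkl : k = l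
    · simp [hkl]
    · have : ∀ᶠ p in nhds q, p k ≠ p l :=
        (isOpen_ne_fun (continuous_apply k) (continuous_apply l)).mem_nhds (hdist k l hkl)
      filter_upwards [this] with p hp _ using hp
  have hfe : f =ᶠ[nhds q] fun q => (N / 2 : ℝ) * ∑ k, ‖q k‖ ^ 2 +
        (1 / (A - 2)) * ∑ k, ∑ l ∈ Finset.Ioi k, ‖q k - q l‖ ^ (2 - A) := by
    filter_upwards [hopen] with p hp using hf p hp
  have hd1 : ∀ k : Fin N, HasFDerivAt (fun q : Fin N → ℂ => ‖q k‖ ^ 2)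
      (2 • (innerSL ℝ (q k)).comp (ContinuousLinearMap.proj (R := ℝ) (φ := fun _ : Fin N => ℂ) k)) q :=
    fun k => (ContinuousLinearMap.proj (R := ℝ) (φ := fun _ : Fin N => ℂ) k).hasFDerivAt.norm_sq
  have hd2 := HasFDerivAt.fun_sum (u := (Finset.univ : Finset (Fin N))) fun k _ =>
    HasFDerivAt.fun_sum (u := Finset.Ioi k) fun l hl =>
      aux_rpow_deriv A hA q k l (hdist k l (Finset.mem_Ioi.1 hl).ne)
  have hd := (((HasFDerivAt.fun_sum (u := (Finset.univ : Finset (Fin N))) fun k _ => hd1 k).const_mul (N / 2 : ℝ)).add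
    (hd2.const_mul (1 / (A - 2)))).congr_of_eventuallyEq hfe
  have key : ∀ v, fderiv ℝ f q v = (N - r ^ (-A) * (S / 2)) * ∑ k, inner ℝ (q k) (v k) := by
    intro v
    rw [hd.fderiv]
    set G : Fin N → Fin N → ℝ := fun k l =>
      ‖q k - q l‖ ^ (-A) * inner ℝ (q k - q l) (v k - v l) with hG
    have hs := aux_sym G (by
      intro k l
      simp only [hG]
      rw [norm_sub_rev, ← neg_sub (q l), ← neg_sub (v l), inner_neg_neg]) (by
      intro k; simp [hG])
    have hH : ∑ k, ∑ l, G k l = 2 * (r ^ (-A) * (S / 2) * ∑ k, inner ℝ (q k) (v k)) := by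
      have e1 : ∀ k, ∑ l, ‖q k - q l‖ ^ (-A) * inner ℝ (q k - q l) (v k)
          = r ^ (-A) * (S / 2) * inner ℝ (q k) (v k) := by
        intro k
        have := congrArg (fun z => inner ℝ z (v k)) (hsum k)
        simp only [← Complex.real_smul, sum_inner, real_inner_smul_left] at this
        exact this
      have e2 : ∑ k, ∑ l, ‖q k - q l‖ ^ (-A) * inner ℝ (q k - q l) (v l)
          = - ∑ k, ∑ l, ‖q k - q l‖ ^ (-A) * inner ℝ (q k - q l) (v k) := by
        rw [Finset.sum_comm, ← Finset.sum_neg_distrib]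
        refine Finset.sum_congr rfl fun k _ => ?_
        rw [← Finset.sum_neg_distrib]
        refine Finset.sum_congr rfl fun l _ => ?_
        rw [norm_sub_rev, ← neg_sub (q k), inner_neg_left]; ring
      simp only [hG, inner_sub_right, mul_sub, Finset.sum_sub_distrib]
      rw [e2]
      simp_rw [e1]
      rw [← Finset.mul_sum]; ring
    have hH' : ∑ k, ∑ l ∈ Finset.Ioi k, G k l = r ^ (-A) * (S / 2) * ∑ k, inner ℝ (q k) (v k) := by
      linarith
    have hA' : A - 2 ≠ 0 := by linarith
    have hL : ∑ k, ∑ l ∈ Finset.Ioi k, ((2 - A) * ‖q k - q l‖ ^ (-A)) * inner ℝ (q k - q l) (v k - v l)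
        = (2 - A) * (r ^ (-A) * (S / 2) * ∑ k, inner ℝ (q k) (v k)) := by
      rw [← hH']
      simp only [hG, Finset.mul_sum, mul_assoc]
    simp only [ContinuousLinearMap.add_apply, ContinuousLinearMap.smul_apply,
      ContinuousLinearMap.sum_apply, ContinuousLinearMap.comp_apply, ContinuousLinearMap.sub_apply,
      ContinuousLinearMap.proj_apply, innerSL_apply_apply, smul_eq_mul, nsmul_eq_mul]
    rw [hL, ← Finset.mul_sum]
    field_simp
    push_cast
    ring
  have hiff : fderiv ℝ f q = 0 ↔ (N - r ^ (-A) * (S / 2) : ℝ) = 0 := by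
    constructor
    · intro h
      have h1 := key q
      rw [h] at h1
      have hp : 0 < ∑ k, inner ℝ (q k) (q k) := by
        haveI : NeZero N := ⟨hN0⟩
        apply Finset.sum_pos
        · intro k _
          rw [real_inner_self_eq_norm_sq, hq, norm_mul, Complex.norm_exp_ofReal_mul_I]
          simp only [Complex.norm_real, mul_one]
          have : ‖r‖ ≠ 0 := norm_ne_zero_iff.2 hr.ne'
          positivity
        · exact Finset.univ_nonempty
      rcases mul_eq_zero.1 h1.symm with h2 | h2
      · exact h2
      · exact absurd h2 hp.ne'
    · intro h
      ext v
      rw [key, h]; simp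
  rw [hiff, Real.rpow_neg hr.le]
  have hrA : 0 < r ^ A := Real.rpow_pos_of_pos hr A
  rw [eq_div_iff (by positivity)]
  constructor
  · intro h
    field_simp at h
    linarith
  · intro h
    field_simp
    linarith
end

section
/- Let N ≥ 2 be an integer. Define the vortex (logarithmic) function f on configurations q = (q_0,…,q_{N−1}) of N distinct points in ℝ² by f(q) = (N/2)·∑_{k=0}^{N−1} |q_k|² − ∑_{0≤k<l≤N−1} log|q_k − q_l|. For r > 0 let q(r) be the regular N-gon configuration q_k = r·(cos(2πk/N), sin(2πk/N)). Then q(r) is a critical point of f if and only if r = sqrt((N−1)/(2N)). -/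
open Real Finset

lemma aux_inner (z v : ℂ) (hz : z ≠ 0) : inner ℝ z v = ‖z‖ ^ 2 * (v / z).re := by
  have h : Complex.normSq z ≠ 0 := by simpa using hz
  rw [Complex.inner, ← Complex.normSq_eq_norm_sq, Complex.div_re]
  field_simp
  simp

lemma aux_log {E : Type*} [NormedAddCommGroup E] [NormedSpace ℝ E] (L : E →L[ℝ] ℂ) (q : E)
    (h : L q ≠ 0) :
    ∃ D : E →L[ℝ] ℝ, HasFDerivAt (fun p => Real.log ‖L p‖) D q ∧ ∀ v, D v = (L v / L q).re := by
  have h1 := (L.hasFDerivAt (x := q)).norm_sq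
  have hn : ‖L q‖ ≠ 0 := by simpa using h
  have h2 := (h1.log (by positivity)).const_mul (1/2 : ℝ)
  refine ⟨_, h2.congr_of_eventuallyEq (Filter.Eventually.of_forall fun p => ?_), fun v => ?_⟩
  · simp [Real.log_pow]
  · simp only [ContinuousLinearMap.smul_apply, ContinuousLinearMap.comp_apply, innerSL_apply_apply,
      smul_eq_mul, aux_inner _ _ h, nsmul_eq_mul]
    field_simp
    simp

lemma aux_sum_s1 (N : ℕ) [NeZero N] (q : Fin N → ℂ) (ω c : ℂ) (hc : c ≠ 0) (hω : ω ^ N = 1)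
    (hq : ∀ k : Fin N, q k = c * ω ^ (k : ℕ)) (hd : ∀ k l, k ≠ l → q k ≠ q l) (k : Fin N) :
    ∑ l, q k / (q k - q l) = (N - 1) / 2 := by
  have hω0 : ω ≠ 0 := by
    rintro rfl
    simp [zero_pow (NeZero.ne N)] at hω
  have hadd : ∀ a b : Fin N, ω ^ ((a + b : Fin N) : ℕ) = ω ^ (a : ℕ) * ω ^ (b : ℕ) := by
    intro a b
    rw [Fin.val_add, ← pow_add, ← pow_mod_orderOf, Nat.mod_mod_of_dvd _ (orderOf_dvd_of_pow_eq_one hω),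
      pow_mod_orderOf]
  have hmul : ∀ l, q l * q (k + k - l) = q k * q k := by
    intro l
    rw [hq, hq, hq]
    have h1 := hadd l (k + k - l)
    rw [add_sub_cancel, hadd] at h1
    linear_combination (-c ^ 2) * h1
  have h0 : ∀ l, q l ≠ 0 := fun l => by rw [hq]; positivity
  have h2 : ∑ l, q k / (q k - q l) = ∑ l, q k / (q k - q (k + k - l)) :=
    (Equiv.sum_comp (Equiv.subLeft (k + k)) (fun l => q k / (q k - q l))).symm
  have h3 : ∀ l, q k / (q k - q l) + q k / (q k - q (k + k - l)) = 1 - if l = k then 1 else 0 := by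
    intro l
    split_ifs with h
    · subst h; simp
    · have e : q (k + k - l) = q k * q k / q l := by
        rw [← hmul l]; field_simp [h0 l]
      have hs : q k - q l ≠ 0 := sub_ne_zero.2 (hd _ _ (Ne.symm h))
      have hs' : q l - q k ≠ 0 := sub_ne_zero.2 (hd _ _ h)
      have e2 : q k - q k * q k / q l = q k * (q l - q k) / q l := by
        field_simp [h0 l]
      rw [e, e2]
      have := h0 l
      have := h0 k
      field_simp
      ring
  have h4 : ∑ l, (q k / (q k - q l) + q k / (q k - q (k + k - l))) = N - 1 := by
    rw [Finset.sum_congr rfl fun l _ => h3 l]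
    simp
  rw [Finset.sum_add_distrib, ← h2] at h4
  linear_combination h4 / 2

theorem regular_polygon_vortex_critical_iff_radius
    (N : ℕ) (hN : 2 ≤ N)
    (f : (Fin N → ℂ) → ℝ)
    (hf : ∀ q : Fin N → ℂ, (∀ k l, k ≠ l → q k ≠ q l) →
      f q = (N / 2 : ℝ) * ∑ k, ‖q k‖ ^ 2 -
        ∑ k, ∑ l ∈ Finset.Ioi k, Real.log ‖q k - q l‖)
    (r : ℝ) (hr : 0 < r)
    (q : Fin N → ℂ)
    (hq : ∀ k : Fin N, q k = (r : ℂ) *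
      Complex.exp (((2 * π * (k : ℕ) / N : ℝ) : ℂ) * Complex.I)) :
    fderiv ℝ f q = 0 ↔ r = Real.sqrt ((N - 1) / (2 * N)) := by
  have hN0 : N ≠ 0 := by omega
  haveI : NeZero N := ⟨hN0⟩
  have hprim := Complex.isPrimitiveRoot_exp N hN0
  set ω := Complex.exp (2 * π * Complex.I / N) with hωd
  have hq' : ∀ k : Fin N, q k = (r : ℂ) * ω ^ (k : ℕ) := by
    intro k
    rw [hq, hωd, ← Complex.exp_nat_mul]
    congr 2
    push_cast
    ring
  have hrc : (r : ℂ) ≠ 0 := by exact_mod_cast hr.ne'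
  have hd : ∀ k l, k ≠ l → q k ≠ q l := by
    intro k l hkl h
    rw [hq', hq'] at h
    exact hkl (Fin.ext (hprim.pow_inj k.2 l.2 (mul_left_cancel₀ hrc h)))
  have hsum := aux_sum_s1 N q ω r hrc hprim.pow_eq_one hq' hd
  have hnorm : ∀ k, ‖q k‖ = r := by
    intro k
    rw [hq, norm_mul, Complex.norm_exp_ofReal_mul_I]
    simp [abs_of_pos hr]
  have h0 : ∀ k, q k ≠ 0 := fun k => by
    rw [← norm_pos_iff, hnorm]; exact hr
  have hev : ∀ᶠ p in nhds q, ∀ k l, k ≠ l → p k ≠ p l := by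
    simp only [Filter.eventually_all]
    intro k l hkl
    exact (isOpen_ne_fun (continuous_apply k) (continuous_apply l)).mem_nhds (hd k l hkl)
  let P : Fin N → ((Fin N → ℂ) →L[ℝ] ℂ) := fun k => ContinuousLinearMap.proj k
  have hlog : ∀ k l : Fin N, ∃ D : (Fin N → ℂ) →L[ℝ] ℝ, k ≠ l →
      HasFDerivAt (fun p : Fin N → ℂ => Real.log ‖p k - p l‖) D q ∧
        ∀ v, D v = ((v k - v l) / (q k - q l)).re := by
    intro k l
    by_cases hkl : k = l
    · exact ⟨0, fun h => (h hkl).elim⟩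
    · obtain ⟨D, h1, h2⟩ := aux_log (P k - P l) q (sub_ne_zero.2 (hd k l hkl))
      exact ⟨D, fun _ => ⟨h1, h2⟩⟩
  choose D hD using hlog
  have hder : HasFDerivAt f ((N / 2 : ℝ) • ∑ k, 2 • (innerSL ℝ (q k)).comp (P k) -
      ∑ k, ∑ l ∈ Finset.Ioi k, D k l) q := by
    refine HasFDerivAt.congr_of_eventuallyEq ?_ (hev.mono fun p hp => hf p hp)
    refine HasFDerivAt.sub (HasFDerivAt.const_mul (HasFDerivAt.fun_sum fun k _ => ?_) _)
      (HasFDerivAt.fun_sum fun k _ => HasFDerivAt.fun_sum fun l hl => ?_)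
    · exact ((P k).hasFDerivAt (x := q)).norm_sq
    · exact (hD k l (Finset.mem_Ioi.1 hl).ne).1
  have hval : ∀ v, fderiv ℝ f q v = (N * r ^ 2 - (N - 1) / 2) * ∑ k, (v k / q k).re := by
    intro v
    have e1 : ∑ k, ∑ l ∈ Finset.Ioi k, D k l v = (N - 1) / 2 * ∑ k, (v k / q k).re := by
      have s1 : ∀ k, ∀ l ∈ Finset.Ioi k, D k l v =
          (v k / (q k - q l)).re + (v l / (q l - q k)).re := by
        intro k l hl
        rw [(hD k l (Finset.mem_Ioi.1 hl).ne).2, ← Complex.add_re, ← neg_sub (q k) (q l), div_neg,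
          sub_div, sub_eq_add_neg]
      rw [Finset.sum_congr rfl fun k _ => Finset.sum_congr rfl (s1 k),
        Finset.sum_sum_Ioi_add_eq_sum_sum_off_diag (fun l k => (v k / (q k - q l)).re), Finset.mul_sum]
      refine Finset.sum_congr rfl fun k _ => ?_
      have s2 : ∑ l ∈ ({k}ᶜ : Finset (Fin N)), (v k / (q k - q l)).re
          = ∑ l, (v k / (q k - q l)).re := by
        refine Finset.sum_subset (Finset.subset_univ _) fun l _ hl => ?_
        have : l = k := by simpa using hl
        simp [this]
      rw [s2, ← Complex.re_sum]
      have s3 : ∑ l, v k / (q k - q l) = ((((N : ℝ) - 1) / 2 : ℝ) : ℂ) * (v k / q k) := by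
        push_cast
        rw [← hsum k, Finset.sum_mul]
        refine Finset.sum_congr rfl fun l _ => ?_
        have := h0 k
        field_simp
      rw [s3, Complex.re_ofReal_mul]
    rw [hder.fderiv]
    simp only [ContinuousLinearMap.sub_apply, ContinuousLinearMap.smul_apply,
      ContinuousLinearMap.sum_apply, ContinuousLinearMap.comp_apply, innerSL_apply_apply, e1]
    have e2 : ∀ k, inner ℝ (q k) (P k v) = r ^ 2 * (v k / q k).re := by
      intro k
      rw [aux_inner _ _ (h0 k), hnorm]
      rfl
    simp only [e2, nsmul_eq_mul, smul_eq_mul, ← Finset.mul_sum]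
    push_cast
    ring
  have hNr : (0 : ℝ) < N := by positivity
  have key : fderiv ℝ f q = 0 ↔ N * r ^ 2 - ((N : ℝ) - 1) / 2 = 0 := by
    constructor
    · intro h
      have := hval q
      rw [h] at this
      simp [h0, hN0] at this
      linarith
    · intro h
      ext1 v
      rw [hval, h]; simp
  rw [key, eq_comm (a := r), Real.sqrt_eq_iff_mul_self_eq_of_pos hr]
  rw [eq_div_iff (by positivity)]
  constructor <;> intro h <;> linarith
end

section
/- Fix an integer N ≥ 2 and for real A > 2 define r(N,A) = ((∑_{j=1}^{N−1} (2 sin(πj/N))^{2−A})/(2N))^{1/A}, the radius at which the equal-mass regular N-gon is a central configuration for the homogeneous potential with exponent A. Then r(N,A) tends to 1/(2 sin(π/N)) as A → ∞. -/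
open Real Finset Filter

lemma aux_sin (N j : ℕ) (hN : 2 ≤ N) (h1 : 1 ≤ j) (h2 : j ≤ N - 1) :
    Real.sin (π / N) ≤ Real.sin (π * j / N) := by
  have hNpos : (0 : ℝ) < N := by positivity
  have hj1 : (1 : ℝ) ≤ j := by exact_mod_cast h1
  have hj2 : (j : ℝ) + 1 ≤ N := by
    have : j + 1 ≤ N := by omega
    exact_mod_cast this
  have hpi := Real.pi_pos
  have ha : π / N ≤ π * j / N := by
    gcongr
    nlinarith
  have hb : π / N ≤ π - π * j / N := by
    rw [le_sub_iff_add_le, ← add_div, div_le_iff₀ hNpos]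
    nlinarith
  have h0 : 0 < π / N := by positivity
  rcases le_total (π * j / N) (π / 2) with h | h
  · exact Real.sin_le_sin_of_le_of_le_pi_div_two (by linarith) h ha
  · rw [← Real.sin_pi_sub (π * j / N)]
    exact Real.sin_le_sin_of_le_of_le_pi_div_two (by linarith) (by linarith) hb

lemma aux_lim (c d : ℝ) (hc : 0 < c) (hd : 0 < d) :
    Tendsto (fun A : ℝ => (c * d ^ (2 - A)) ^ (1 / A)) atTop (nhds (1 / d)) := by
  have h1 : Tendsto (fun A : ℝ => (c * d ^ (2 : ℝ)) ^ (1 / A) * (1 / d)) atTop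
      (nhds ((c * d ^ (2 : ℝ)) ^ (0 : ℝ) * (1 / d))) := by
    refine Tendsto.mul_const _ ?_
    have h0 : Tendsto (fun A : ℝ => 1 / A) atTop (nhds 0) := by
      simpa using tendsto_inv_atTop_zero (𝕜 := ℝ)
    exact tendsto_const_nhds.rpow h0 (Or.inl (by positivity))
  rw [Real.rpow_zero, one_mul] at h1
  refine h1.congr' ?_
  filter_upwards [eventually_gt_atTop 0] with A hA
  have : c * d ^ (2 - A) = (c * d ^ (2 : ℝ)) * d ^ (-A) := by
    rw [sub_eq_add_neg, Real.rpow_add hd, mul_assoc]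
  rw [this, Real.mul_rpow (x := c * d ^ (2 : ℝ)) (y := d ^ (-A)) (by positivity) (by positivity),
    ← Real.rpow_mul hd.le (-A)]
  have : -A * (1 / A) = -1 := by field_simp
  rw [this, Real.rpow_neg_one, one_div d]

/-- For fixed `N ≥ 2`, the critical radius
`r(N,A) = ((∑_{j=1}^{N-1} (2 sin(πj/N))^(2-A))/(2N))^(1/A)` of the equal-mass regular
`N`-gon tends to `1/(2 sin(π/N))` as `A → ∞`. -/
theorem regular_polygon_radius_tendsto
    (N : ℕ) (hN : 2 ≤ N) :
    Tendsto (fun A : ℝ =>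
        ((∑ j ∈ Finset.Icc 1 (N - 1), (2 * Real.sin (π * j / N)) ^ (2 - A)) / (2 * N)) ^ (1 / A))
      atTop (nhds (1 / (2 * Real.sin (π / N)))) := by
  have hNpos : (0 : ℝ) < N := by positivity
  have hN2 : (2 : ℝ) ≤ N := by exact_mod_cast hN
  have hs : 0 < Real.sin (π / N) := by
    apply Real.sin_pos_of_pos_of_lt_pi (by positivity)
    rw [div_lt_iff₀ hNpos]
    nlinarith [Real.pi_pos]
  have hd : 0 < 2 * Real.sin (π / N) := by positivity
  have hle : ∀ j ∈ Finset.Icc 1 (N - 1), 2 * Real.sin (π / N) ≤ 2 * Real.sin (π * j / N) := by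
    intro j hj
    rw [Finset.mem_Icc] at hj
    have := aux_sin N j hN hj.1 hj.2
    linarith
  have hpos : ∀ A : ℝ, ∀ j ∈ Finset.Icc 1 (N - 1), 0 ≤ (2 * Real.sin (π * j / N)) ^ (2 - A) :=
    fun A j hj => Real.rpow_nonneg (hd.le.trans (hle j hj)) _
  refine tendsto_of_tendsto_of_tendsto_of_le_of_le'
    (aux_lim (1 / (2 * N)) _ (by positivity) hd) (aux_lim (N / (2 * N)) _ (by positivity) hd) ?_ ?_
  · filter_upwards [eventually_gt_atTop 2] with A hA
    have key := Finset.single_le_sum (hpos A)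
      (Finset.mem_Icc.2 ⟨le_refl 1, by omega⟩ : 1 ∈ Finset.Icc 1 (N - 1))
    simp only [Nat.cast_one, mul_one] at key
    apply Real.rpow_le_rpow (by positivity) _ (by positivity)
    rw [one_div_mul_eq_div]
    gcongr
  · filter_upwards [eventually_gt_atTop 2] with A hA
    have key := Finset.sum_le_card_nsmul (Finset.Icc 1 (N - 1))
      (fun j : ℕ => (2 * Real.sin (π * j / N)) ^ (2 - A)) ((2 * Real.sin (π / N)) ^ (2 - A))
      (fun j hj => Real.rpow_le_rpow_of_nonpos hd (hle j hj) (by linarith))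
    rw [nsmul_eq_mul] at key
    have hcard : ((Finset.Icc 1 (N - 1)).card : ℝ) ≤ N := by
      have : (Finset.Icc 1 (N - 1)).card ≤ N := by simp
      exact_mod_cast this
    apply Real.rpow_le_rpow (div_nonneg (Finset.sum_nonneg (hpos A)) (by positivity)) _
      (by positivity)
    rw [div_mul_eq_mul_div]
    gcongr
    refine key.trans ?_
    gcongr
end

section
/- For every integer N ≥ 3 and every integer i with 0 ≤ i ≤ N, one has ∑_{j=1}^{⌊(N−1)/2⌋} (1 − cos(2πij/N))/(1 − cos(2πj/N)) = ⌊(iN − i²)/2⌋. -/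
open Real Finset

lemma vq_tel (t : ℝ) (m : ℕ) :
    sin (t / 2) * ∑ j ∈ Finset.Icc 1 m, 2 * cos (t * j) = sin (t * m + t / 2) - sin (t / 2) := by
  induction m with
  | zero => simp
  | succ m ih =>
    rw [Finset.sum_Icc_succ_top (by omega), mul_add, ih]
    have h1 : t * (m:ℝ) + t / 2 = t * ((m + 1 : ℕ) : ℝ) - t / 2 := by push_cast; ring
    rw [h1, sin_add, sin_sub]
    ring

lemma vq_C (N k m : ℕ) (e : ℝ) (hk : 0 < k) (hkN : k < N)
    (h : (N = 2 * m + 1 ∧ e = 0) ∨ (N = 2 * m + 2 ∧ e = 1)) :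
    ∑ j ∈ Finset.Icc 1 m, 2 * cos (2 * π * k / N * j) = -1 - e * (-1) ^ k := by
  have hN : (0:ℝ) < N := by exact_mod_cast (by omega : 0 < N)
  have hk' : (0:ℝ) < k := by exact_mod_cast hk
  have hkN' : (k:ℝ) < N := by exact_mod_cast hkN
  have hs : 0 < sin (2 * π * k / N / 2) := by
    apply sin_pos_of_pos_of_lt_pi
    · have := pi_pos
      positivity
    · rw [div_div, div_lt_iff₀ (by positivity)]
      nlinarith [pi_pos]
  have ht := vq_tel (2 * π * k / N) m
  apply mul_left_cancel₀ hs.ne'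
  rw [ht]
  rcases h with ⟨h, rfl⟩ | ⟨h, rfl⟩
  · have h' : (N:ℝ) = 2 * m + 1 := by exact_mod_cast h
    have : 2 * π * k / N * m + 2 * π * k / N / 2 = k * π := by
      field_simp
      rw [h']
    rw [this, sin_nat_mul_pi]; ring
  · have h' : (N:ℝ) = 2 * m + 2 := by exact_mod_cast h
    have : 2 * π * k / N * m + 2 * π * k / N / 2 = k * π - 2 * π * k / N / 2 := by
      field_simp
      rw [h']; ring
    rw [this, sin_sub, sin_nat_mul_pi, cos_nat_mul_pi]; ring

lemma vq_S (N m : ℕ) (e : ℝ) (hN : 3 ≤ N)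
    (h : (N = 2 * m + 1 ∧ e = 0) ∨ (N = 2 * m + 2 ∧ e = 1)) (i : ℕ) (hi : i ≤ N) :
    ∑ j ∈ Finset.Icc 1 m,
        (1 - Real.cos (2 * π * i * j / N)) / (1 - Real.cos (2 * π * j / N)) =
      ((i : ℝ) * N - (i : ℝ) ^ 2) / 2 - e * (1 - (-1) ^ i) / 4 := by
  have hN0 : (0:ℝ) < N := by exact_mod_cast (by omega : 0 < N)
  have hd : ∀ j ∈ Finset.Icc 1 m, 1 - Real.cos (2 * π * j / N) ≠ 0 := by
    intro j hj
    rw [Finset.mem_Icc] at hj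
    have hj1 : (0:ℝ) < j := by exact_mod_cast hj.1
    have hj2 : (j:ℝ) < N := by exact_mod_cast (by omega : j < N)
    have hs : 0 < sin (π * j / N) := by
      apply sin_pos_of_pos_of_lt_pi
      · have := pi_pos
        positivity
      · rw [div_lt_iff₀ (by positivity)]
        nlinarith [pi_pos]
    have : 2 * π * j / N = 2 * (π * j / N) := by ring
    rw [this, cos_two_mul]
    have := sin_sq_add_cos_sq (π * j / N)
    have : 0 < sin (π * j / N) ^ 2 := by positivity
    intro h0
    linarith
  induction i using Nat.twoStepInduction with
  | zero => simp
  | one =>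
    rw [Finset.sum_congr rfl (g := fun _ => (1:ℝ))]
    · rcases h with ⟨h, rfl⟩ | ⟨h, rfl⟩
      · have h' : (N:ℝ) = 2 * m + 1 := by exact_mod_cast h
        simp [h']
      · have h' : (N:ℝ) = 2 * m + 2 := by exact_mod_cast h
        simp [h']; ring
    · intro j hj
      have := hd j hj
      simp only [Nat.cast_one, mul_one]
      exact div_self this
  | more i ih1 ih2 =>
    have a := ih1 (by omega)
    have b := ih2 (by omega)
    have c := vq_C N (i+1) m e (by omega) (by omega) h
    have key : ∑ j ∈ Finset.Icc 1 m,
        (1 - Real.cos (2 * π * ((i + 2 : ℕ):ℝ) * j / N)) / (1 - Real.cos (2 * π * j / N)) =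
        2 * ∑ j ∈ Finset.Icc 1 m,
        (1 - Real.cos (2 * π * ((i + 1 : ℕ):ℝ) * j / N)) / (1 - Real.cos (2 * π * j / N))
        - ∑ j ∈ Finset.Icc 1 m,
        (1 - Real.cos (2 * π * i * j / N)) / (1 - Real.cos (2 * π * j / N))
        + ∑ j ∈ Finset.Icc 1 m, 2 * cos (2 * π * ((i + 1 : ℕ):ℝ) / N * j) := by
      rw [Finset.mul_sum, ← Finset.sum_sub_distrib, ← Finset.sum_add_distrib]
      apply Finset.sum_congr rfl
      intro j hj
      have h0 := hd j hj
      have e1 : 2 * π * ((i + 2 : ℕ):ℝ) * j / N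
        = 2 * π * ((i + 1 : ℕ):ℝ) / N * j + 2 * π * j / N := by push_cast; ring
      have e2 : 2 * π * (i:ℝ) * j / N
        = 2 * π * ((i + 1 : ℕ):ℝ) / N * j - 2 * π * j / N := by push_cast; ring
      have e3 : 2 * π * ((i + 1 : ℕ):ℝ) * j / N
        = 2 * π * ((i + 1 : ℕ):ℝ) / N * j := by ring
      rw [e1, e2, e3, cos_add, cos_sub]
      generalize cos (2 * π * j / N) = x at *
      field_simp
      ring
    rw [key, a, b, c]
    push_cast
    ring

theorem vortex_Q_diagonal_value
    (N : ℕ) (hN : 3 ≤ N) (i : ℕ) (hi : i ≤ N) :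
    ∑ j ∈ Finset.Icc 1 ((N - 1) / 2),
        (1 - Real.cos (2 * π * i * j / N)) / (1 - Real.cos (2 * π * j / N)) =
      ((⌊((i : ℝ) * N - (i : ℝ) ^ 2) / 2⌋ : ℤ) : ℝ) := by
  obtain ⟨d, rfl⟩ := Nat.exists_eq_add_of_le hi
  have hfl : ∀ (z : ℤ) (r : ℝ), 0 ≤ r → r < 1 →
      ((i : ℝ) * ((i + d : ℕ):ℝ) - (i : ℝ) ^ 2) / 2 = z + r →
      ((⌊((i : ℝ) * ((i + d : ℕ):ℝ) - (i : ℝ) ^ 2) / 2⌋ : ℤ) : ℝ)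
        = ((i : ℝ) * ((i + d : ℕ):ℝ) - (i : ℝ) ^ 2) / 2 - r := by
    intro z r h0 h1 h
    have : ⌊((i : ℝ) * ((i + d : ℕ):ℝ) - (i : ℝ) ^ 2) / 2⌋ = z := by
      rw [Int.floor_eq_iff]; constructor <;> linarith
    rw [this]; linarith
  rcases Nat.even_or_odd' i with ⟨a, ha | ha⟩ <;> rcases Nat.even_or_odd' d with ⟨b, hb | hb⟩
  · rw [vq_S (i+d) _ 1 hN (Or.inr ⟨by omega, rfl⟩) i hi,
      hfl (a * d) 0 le_rfl one_pos (by rw [ha]; push_cast; ring), Even.neg_one_pow ⟨a, by omega⟩]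
    ring
  · rw [vq_S (i+d) _ 0 hN (Or.inl ⟨by omega, rfl⟩) i hi,
      hfl (a * d) 0 le_rfl one_pos (by rw [ha]; push_cast; ring)]
    ring
  · rw [vq_S (i+d) _ 0 hN (Or.inl ⟨by omega, rfl⟩) i hi,
      hfl (i * b) 0 le_rfl one_pos (by rw [hb]; push_cast; ring)]
    ring
  · rw [vq_S (i+d) _ 1 hN (Or.inr ⟨by omega, rfl⟩) i hi,
      hfl (2 * a * b + a + b) (1/2) (by norm_num) (by norm_num)
        (by rw [ha, hb]; push_cast; ring), Odd.neg_one_pow ⟨a, by omega⟩]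
    ring
end

section
/- For every integer N ≥ 3, one has ∑_{j=1}^{⌊(N−1)/2⌋} (1 + 2 cos(2πj/N))² = ⌊(3N − 9)/2⌋. -/
open Real Finset

lemma vortex_aux (x : ℝ) (m : ℕ) :
    2 * Real.sin x * ∑ j ∈ Finset.Icc 1 m, Real.cos (2 * x * j) =
      Real.sin ((2 * m + 1) * x) - Real.sin x := by
  induction m with
  | zero => simp
  | succ k ih =>
    rw [Finset.sum_Icc_succ_top (by omega), mul_add, ih]
    have h1 : (2 * ((k + 1 : ℕ) : ℝ) + 1) * x = 2 * x * ((k + 1 : ℕ) : ℝ) + x := by ring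
    have h2 : (2 * (k : ℝ) + 1) * x = 2 * x * ((k + 1 : ℕ) : ℝ) - x := by push_cast; ring
    rw [h1, h2, Real.sin_add, Real.sin_sub]
    ring

/-- For `N ≥ 3`, `∑_{j=1}^{⌊(N-1)/2⌋} (1 + 2cos(2πj/N))² = ⌊(3N - 9)/2⌋`. -/
theorem vortex_Q_diagonal_i_three
    (N : ℕ) (hN : 3 ≤ N) :
    ∑ j ∈ Finset.Icc 1 ((N - 1) / 2), (1 + 2 * Real.cos (2 * π * j / N)) ^ 2 =
      ((⌊((3 * (N : ℝ) - 9)) / 2⌋ : ℤ) : ℝ) := by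
  have hN' : (3 : ℝ) ≤ N := by exact_mod_cast hN
  have hN0 : (N : ℝ) ≠ 0 := by positivity
  obtain ⟨a, ha⟩ : ∃ a : ℝ, a = π / N := ⟨_, rfl⟩
  have haN : N * a = π := by rw [ha]; field_simp
  have ha0 : 0 < a := by rw [ha]; positivity
  have ha3 : 2 * a < π := by nlinarith
  have hs1 : Real.sin a ≠ 0 := (Real.sin_pos_of_pos_of_lt_pi ha0 (by linarith)).ne'
  have hs2 : Real.sin (2 * a) ≠ 0 :=
    (Real.sin_pos_of_pos_of_lt_pi (by linarith) ha3).ne'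
  obtain ⟨m, hm⟩ : ∃ m, m = (N - 1) / 2 := ⟨_, rfl⟩
  rw [← hm]
  have key : ∑ j ∈ Finset.Icc 1 m, (1 + 2 * Real.cos (2 * π * j / N)) ^ 2 =
      3 * m + 4 * ∑ j ∈ Finset.Icc 1 m, Real.cos (2 * a * j)
        + 2 * ∑ j ∈ Finset.Icc 1 m, Real.cos (2 * (2 * a) * j) := by
    have h3 : (3 * m : ℝ) = ∑ j ∈ Finset.Icc 1 m, (3 : ℝ) := by simp; ring
    rw [h3, Finset.mul_sum, Finset.mul_sum, ← Finset.sum_add_distrib,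
      ← Finset.sum_add_distrib]
    refine Finset.sum_congr rfl fun j _ => ?_
    have e1 : 2 * π * j / N = 2 * a * j := by rw [ha]; ring
    have e2 : 2 * (2 * a) * j = 2 * (2 * a * j) := by ring
    rw [e1, e2, Real.cos_two_mul]
    ring
  have A := vortex_aux a m
  have B := vortex_aux (2 * a) m
  rw [key]
  generalize ∑ j ∈ Finset.Icc 1 m, Real.cos (2 * a * j) = S at *
  generalize ∑ j ∈ Finset.Icc 1 m, Real.cos (2 * (2 * a) * j) = T at *
  rcases (by omega : N = 2 * m + 1 ∨ N = 2 * m + 2) with h | h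
  · have hc : (N : ℝ) = 2 * m + 1 := by rw [h]; push_cast; ring
    have f : ⌊((3 * (N : ℝ) - 9)) / 2⌋ = 3 * (m : ℤ) - 3 := by
      rw [Int.floor_eq_iff, hc]; push_cast; constructor <;> linarith
    rw [show (2 * (m : ℝ) + 1) * a = π by rw [← hc, haN], Real.sin_pi] at A
    rw [show (2 * (m : ℝ) + 1) * (2 * a) = 2 * π by rw [← hc, ← haN]; ring,
      Real.sin_two_pi] at B
    have hS : 2 * S = -1 := mul_left_cancel₀ hs1 (by linarith)
    have hT : 2 * T = -1 := mul_left_cancel₀ hs2 (by linarith)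
    rw [f]; push_cast; linarith
  · have hc : (N : ℝ) = 2 * m + 2 := by rw [h]; push_cast; ring
    have f : ⌊((3 * (N : ℝ) - 9)) / 2⌋ = 3 * (m : ℤ) - 2 := by
      rw [Int.floor_eq_iff, hc]; push_cast; constructor <;> linarith
    rw [show (2 * (m : ℝ) + 1) * a = π - a by rw [← haN, hc]; ring, Real.sin_pi_sub] at A
    rw [show (2 * (m : ℝ) + 1) * (2 * a) = 2 * π - 2 * a by rw [← haN, hc]; ring,
      Real.sin_two_pi_sub] at B
    have hS : 2 * S = 0 := mul_left_cancel₀ hs1 (by linarith)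
    have hT : 2 * T = -2 := mul_left_cancel₀ hs2 (by linarith)
    rw [f]; push_cast; linarith
end

section
/- For every integer N ≥ 8, exactly N − 5 of the 2N real numbers { (2−i)·N + (i² − i)·N/(N−1) : 0 ≤ i ≤ N−1 } ∪ { ⌊(iN − i²)/2⌋ : 0 ≤ i ≤ N−1 } (counted with multiplicity, i.e. as a list of 2N numbers indexed by i and type) are negative; equivalently, the cardinality of { i : 0 ≤ i ≤ N−1 and (2−i)·N + (i² − i)·N/(N−1) < 0 } equals N − 5 and ⌊(iN − i²)/2⌋ ≥ 0 for all 0 ≤ i ≤ N−1. -/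
open Real Finset

/-- For `N ≥ 8`, exactly `N - 5` of the `2N` vortex Hessian eigenvalues
`P_i^{(2)} = (2-i)·N + (i² - i)·N/(N-1)` and `Q_i^{(2)} = ⌊(iN - i²)/2⌋`, `0 ≤ i ≤ N-1`,
are negative: the set of `i < N` with `P_i^{(2)} < 0` has exactly `N - 5` elements, and all
the `Q_i^{(2)}` are nonnegative. -/
theorem vortex_polygon_morse_index_large_N
    (N : ℕ) (hN : 8 ≤ N) :
    {i : ℕ | i < N ∧ (2 - (i : ℝ)) * N + ((i : ℝ) ^ 2 - i) * N / ((N : ℝ) - 1) < 0}.ncard =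
        N - 5 ∧
      ∀ i : ℕ, i < N → 0 ≤ ⌊((i : ℝ) * N - (i : ℝ) ^ 2) / 2⌋ := by
  have hNR : (8 : ℝ) ≤ N := by exact_mod_cast hN
  have h1 : (0 : ℝ) < (N : ℝ) - 1 := by linarith
  have h0 : (0 : ℝ) < (N : ℝ) := by linarith
  refine ⟨?_, ?_⟩
  · have hset : {i : ℕ | i < N ∧ (2 - (i : ℝ)) * N + ((i : ℝ) ^ 2 - i) * N / ((N : ℝ) - 1) < 0}
        = ((Finset.Icc 3 (N - 3) : Finset ℕ) : Set ℕ) := by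
      ext i
      have key : (2 - (i : ℝ)) * N + ((i : ℝ) ^ 2 - i) * N / ((N : ℝ) - 1)
          = (N / ((N : ℝ) - 1)) * (2 - ((i : ℝ) - 2) * (N - 2 - i)) := by
        field_simp
        ring
      have hc : (0 : ℝ) < N / ((N : ℝ) - 1) := div_pos h0 h1
      simp only [Set.mem_ofPred_eq, Finset.coe_Icc, Set.mem_Icc]
      rw [key, show (N / ((N : ℝ) - 1)) * (2 - ((i : ℝ) - 2) * (N - 2 - i)) < 0 ↔ (2 - ((i : ℝ) - 2) * (N - 2 - i)) < 0 from (mul_neg_iff.trans ⟨fun h => h.elim (fun h => h.2) (fun h => absurd h.1 hc.not_gt), fun h => Or.inl ⟨hc, h⟩⟩)]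
      constructor
      · rintro ⟨hi, h⟩
        have hi' : (i : ℝ) + 1 ≤ N := by exact_mod_cast hi
        constructor
        · by_contra hlt
          have h3 : i ≤ 2 := by omega
          have h4 : (i : ℝ) ≤ 2 := by exact_mod_cast h3
          nlinarith [mul_nonneg (sub_nonneg.2 h4) (by linarith : (0 : ℝ) ≤ N - 2 - i)]
        · by_contra hlt
          have h3 : N ≤ i + 2 := by omega
          have h4 : (N : ℝ) ≤ i + 2 := by exact_mod_cast h3
          nlinarith [mul_nonneg (by linarith : (0 : ℝ) ≤ i - 2) (by linarith : (0 : ℝ) ≤ i + 2 - N)]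
      · rintro ⟨ha, hb⟩
        refine ⟨by omega, ?_⟩
        have ha' : (3 : ℝ) ≤ i := by exact_mod_cast ha
        have h3 : i + 3 ≤ N := by omega
        have hb' : (i : ℝ) + 3 ≤ N := by exact_mod_cast h3
        nlinarith [mul_nonneg (sub_nonneg.2 ha') (sub_nonneg.2 hb')]
    rw [hset, Set.ncard_coe_finset, Nat.card_Icc]
    omega
  · intro i hi
    have hi' : (i : ℝ) ≤ N := by exact_mod_cast hi.le
    apply Int.floor_nonneg.2
    have : (0 : ℝ) ≤ i := Nat.cast_nonneg i
    nlinarith [mul_nonneg this (sub_nonneg.2 hi')]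
end

section
/- Let N ≥ 3 be an integer and A ≥ 2 a real number. With u_j = 2 sin(πj/N), r = ((∑_{j=1}^{N−1} u_j^{2−A})/(2N))^{1/A}, define P_0 = r^{−A}·∑_{j=1}^{⌊(N−1)/2⌋} u_j^{−A}·(u_j²·(A/2 + 1 + (A/2 − 1)) ) + c_N, where c_N = (2r)^{−A}·2A if N is even and c_N = 0 if N is odd; Q_0 = 2r^{2−A}·∑_{j=1}^{⌊(N−1)/2⌋} u_j^{−A}·(1 − cos(0))·(((A−2)/2)(1 + cos(2πj/N)) + 1); and s_0 = (A−2)·r^{1−A}·∑_{j=1}^{⌊(N−1)/2⌋} sin(0)·sin(2πj/N)·u_j^{−A}. Then P_0 = N·A, Q_0 = 0 and s_0 = 0; hence the two eigenvalues of the i = 0 block of the diagonalized Hessian of f at the equal-mass regular N-gon are N·A and 0. -/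
open Real Finset

lemma sum_Icc_one_range (f : ℕ → ℝ) (n : ℕ) :
    ∑ j ∈ Finset.Icc 1 n, f j = ∑ k ∈ Finset.range n, f (k + 1) := by
  induction n with
  | zero => simp
  | succ n ih => rw [Finset.sum_Icc_succ_top (by omega), ih, Finset.sum_range_succ]

lemma sum_symm_odd (f : ℕ → ℝ) (m : ℕ) (hf : ∀ j, j ≤ 2 * m + 1 → f (2 * m + 1 - j) = f j) :
    ∑ j ∈ Finset.Icc 1 (2 * m), f j = 2 * ∑ j ∈ Finset.Icc 1 m, f j := by
  rw [sum_Icc_one_range, sum_Icc_one_range, two_mul m, Finset.sum_range_add, two_mul]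
  congr 1
  rw [← Finset.sum_range_reflect]
  refine Finset.sum_congr rfl fun k hk => ?_
  rw [Finset.mem_range] at hk
  rw [← hf (k + 1) (by omega)]
  congr 1
  omega

lemma sum_symm_even (f : ℕ → ℝ) (m : ℕ) (hf : ∀ j, j ≤ 2 * m + 2 → f (2 * m + 2 - j) = f j) :
    ∑ j ∈ Finset.Icc 1 (2 * m + 1), f j = 2 * ∑ j ∈ Finset.Icc 1 m, f j + f (m + 1) := by
  rw [sum_Icc_one_range, sum_Icc_one_range, show 2 * m + 1 = (m + 1) + m by omega,
    Finset.sum_range_add, two_mul, Finset.sum_range_succ]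
  have : ∑ k ∈ Finset.range m, f (m + 1 + k + 1) = ∑ k ∈ Finset.range m, f (k + 1) := by
    rw [← Finset.sum_range_reflect]
    refine Finset.sum_congr rfl fun k hk => ?_
    rw [Finset.mem_range] at hk
    rw [← hf (k + 1) (by omega)]
    congr 1
    omega
  rw [this]
  ring

/-- For `N ≥ 3` and `A ≥ 2`, with `u_j = 2 sin(πj/N)` and critical radius
`r = ((∑_{j=1}^{N-1} u_j^(2-A))/(2N))^(1/A)`, the `i = 0` block entries
`P₀ = r^(-A)·∑_{j=1}^{⌊(N-1)/2⌋} u_j^(-A)·(u_j²·(A/2 + 1 + (A/2 - 1))) + c_N`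
(`c_N = (2r)^(-A)·2A` for even `N`, `0` for odd `N`),
`Q₀ = 2r^(2-A)·∑ u_j^(-A)·(1 - cos 0)·(((A-2)/2)(1 + cos(2πj/N)) + 1)`, and
`s₀ = (A-2)·r^(1-A)·∑ sin 0·sin(2πj/N)·u_j^(-A)` satisfy `P₀ = N·A`, `Q₀ = 0`, `s₀ = 0`;
hence the two eigenvalues of the `i = 0` Hessian block are `N·A` and `0`. -/
theorem polygon_hessian_block_zero
    (N : ℕ) (hN : 3 ≤ N) (A : ℝ) (hA : 2 ≤ A)
    (u : ℕ → ℝ) (hu : ∀ j, u j = 2 * Real.sin (π * j / N))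
    (r : ℝ) (hr : r = ((∑ j ∈ Finset.Icc 1 (N - 1), u j ^ (2 - A)) / (2 * N)) ^ (1 / A))
    (P₀ Q₀ s₀ : ℝ)
    (hP : P₀ = r ^ (-A) *
        ∑ j ∈ Finset.Icc 1 ((N - 1) / 2), u j ^ (-A) * (u j ^ 2 * (A / 2 + 1 + (A / 2 - 1))) +
      (if Even N then (2 * r) ^ (-A) * (2 * A) else 0))
    (hQ : Q₀ = 2 * r ^ (2 - A) *
        ∑ j ∈ Finset.Icc 1 ((N - 1) / 2), u j ^ (-A) * (1 - Real.cos 0) *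
          ((A - 2) / 2 * (1 + Real.cos (2 * π * j / N)) + 1))
    (hs : s₀ = (A - 2) * r ^ (1 - A) *
        ∑ j ∈ Finset.Icc 1 ((N - 1) / 2),
          Real.sin 0 * Real.sin (2 * π * j / N) * u j ^ (-A)) :
    P₀ = N * A ∧ Q₀ = 0 ∧ s₀ = 0 ∧
      (P₀ + Q₀ + Real.sqrt ((P₀ - Q₀) ^ 2 + 4 * s₀ ^ 2)) / 2 = N * A ∧
      (P₀ + Q₀ - Real.sqrt ((P₀ - Q₀) ^ 2 + 4 * s₀ ^ 2)) / 2 = 0 := by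
  have hN0 : (0 : ℝ) < N := by exact_mod_cast (by omega : 0 < N)
  have hA0 : (0 : ℝ) < A := by linarith
  have hQ0 : Q₀ = 0 := by rw [hQ]; simp
  have hs0 : s₀ = 0 := by rw [hs]; simp
  have hupos : ∀ j ∈ Finset.Icc 1 (N - 1), 0 < u j := by
    intro j hj
    rw [Finset.mem_Icc] at hj
    have h1 : (0 : ℝ) < j := by exact_mod_cast (by omega : 0 < j)
    have h2 : (j : ℝ) < N := by exact_mod_cast (by omega : j < N)
    rw [hu]
    have := Real.sin_pos_of_pos_of_lt_pi (x := π * j / N) (by positivity)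
      (by rw [div_lt_iff₀ hN0]; exact mul_lt_mul_of_pos_left h2 Real.pi_pos)
    linarith
  have husymm : ∀ j, j ≤ N → u (N - j) = u j := by
    intro j hj
    rw [hu, hu, Nat.cast_sub hj, ← Real.sin_pi_sub (π * j / N)]
    congr 2
    field_simp
  set S := ∑ j ∈ Finset.Icc 1 (N - 1), u j ^ (2 - A) with hS
  have hSpos : 0 < S := by
    apply Finset.sum_pos
    · intro j hj
      exact Real.rpow_pos_of_pos (hupos j hj) _
    · exact ⟨1, by rw [Finset.mem_Icc]; omega⟩
  have hrpos : 0 < r := by rw [hr]; positivity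
  have hrA : r ^ (-A) = 2 * N / S := by
    rw [hr, ← Real.rpow_mul (by positivity), show 1 / A * -A = -1 by field_simp,
      Real.rpow_neg_one, inv_div]
  have hT : ∑ j ∈ Finset.Icc 1 ((N - 1) / 2),
      u j ^ (-A) * (u j ^ 2 * (A / 2 + 1 + (A / 2 - 1))) =
      A * ∑ j ∈ Finset.Icc 1 ((N - 1) / 2), u j ^ (2 - A) := by
    rw [Finset.mul_sum]
    refine Finset.sum_congr rfl fun j hj => ?_
    rw [Finset.mem_Icc] at hj
    have := hupos j (by rw [Finset.mem_Icc]; omega)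
    rw [show (2 : ℝ) - A = -A + (2 : ℕ) by push_cast; ring, Real.rpow_add this,
      Real.rpow_natCast]
    ring
  have hP0 : P₀ = N * A := by
    rw [hP, hT]
    rcases Nat.even_or_odd N with he | ho
    · rw [if_pos he, Real.mul_rpow (by norm_num) hrpos.le, hrA]
      obtain ⟨m, hm⟩ : ∃ m, N = 2 * m + 2 := by
        obtain ⟨k, hk⟩ := he
        exact ⟨k - 1, by omega⟩
      have key := sum_symm_even (fun j => u j ^ (2 - A)) m (fun j hj => by
        rw [← hm, husymm j (by omega)])
      have hmid : u (m + 1) = 2 := by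
        rw [hu, hm]
        have : π * ((m + 1 : ℕ) : ℝ) / ((2 * m + 2 : ℕ) : ℝ) = π / 2 := by
          push_cast
          field_simp
        rw [this]; simp
      rw [show 2 * m + 1 = N - 1 by omega, ← hS, show m = (N - 1) / 2 by omega] at key
      rw [show m = (N - 1) / 2 by omega] at hmid
      simp only [hmid] at key
      rw [show (2 : ℝ) - A = -A + (2 : ℕ) by push_cast; ring, Real.rpow_add two_pos,
        Real.rpow_natCast, show -A + ((2 : ℕ) : ℝ) = 2 - A by push_cast; ring] at key
      field_simp
      linarith
    · rw [if_neg (by rwa [Nat.not_even_iff_odd]), hrA]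
      obtain ⟨m, hm⟩ := ho
      have key := sum_symm_odd (fun j => u j ^ (2 - A)) m (fun j hj => by
        rw [← hm, husymm j (by omega)])
      rw [show 2 * m = N - 1 by omega, ← hS, show m = (N - 1) / 2 by omega] at key
      field_simp
      linear_combination (-(N : ℝ) * A) * key
  have hsq : Real.sqrt ((P₀ - Q₀) ^ 2 + 4 * s₀ ^ 2) = N * A := by
    rw [hP0, hQ0, hs0, show ((N : ℝ) * A - 0) ^ 2 + 4 * 0 ^ 2 = (N * A) ^ 2 by ring]
    exact Real.sqrt_sq (by positivity)
  refine ⟨hP0, hQ0, hs0, ?_, ?_⟩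
  · rw [hsq, hP0, hQ0]; ring
  · rw [hsq, hP0, hQ0]; ring
end

section
/- Let N ≥ 3 be an integer and A ≥ 2 a real number. With u_j = 2 sin(πj/N), r = ((∑_{j=1}^{N−1} u_j^{2−A})/(2N))^{1/A}, define P_1 = r^{−A}·∑_{j=1}^{⌊(N−1)/2⌋} u_j^{−A}·( u_j²·(A/2 + 1 + (A/2 − 1)cos(2πj/N)) − 2 + 2cos(2πj/N) ) + c_N, where c_N = (2r)^{−A}·(−(A−1) + (A+1)) if N is even and c_N = 0 if N is odd; Q_1 = 2r^{2−A}·∑_{j=1}^{⌊(N−1)/2⌋} u_j^{−A}·(1 − cos(2πj/N))·(((A−2)/2)(1 + cos(2πj/N)) + 1); and s_1 = (A−2)·r^{1−A}·∑_{j=1}^{⌊(N−1)/2⌋} sin(2πj/N)²·u_j^{−A}. Then P_1·Q_1 − s_1² > 0 and P_1 + Q_1 > 0; consequently both eigenvalues λ_{(N,1,±)} = (P_1 + Q_1 ± sqrt((P_1 − Q_1)² + 4 s_1²))/2 of the i = 1 Hessian block are strictly positive. -/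
open Real Finset

/-- For `N ≥ 3` and `A ≥ 2`, with `u_j = 2 sin(πj/N)` and critical radius
`r = ((∑_{j=1}^{N-1} u_j^(2-A))/(2N))^(1/A)`, the `i = 1` Hessian block entries `P₁, Q₁, s₁`
satisfy `P₁·Q₁ - s₁² > 0` and `P₁ + Q₁ > 0`; consequently both eigenvalues
`λ_{(N,1,±)} = (P₁ + Q₁ ± sqrt((P₁ - Q₁)² + 4s₁²))/2` are strictly positive. -/
theorem polygon_hessian_block_one_positive
    (N : ℕ) (hN : 3 ≤ N) (A : ℝ) (hA : 2 ≤ A)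
    (u : ℕ → ℝ) (hu : ∀ j, u j = 2 * Real.sin (π * j / N))
    (r : ℝ) (hr : r = ((∑ j ∈ Finset.Icc 1 (N - 1), u j ^ (2 - A)) / (2 * N)) ^ (1 / A))
    (P₁ Q₁ s₁ : ℝ)
    (hP : P₁ = r ^ (-A) *
        ∑ j ∈ Finset.Icc 1 ((N - 1) / 2),
          u j ^ (-A) * (u j ^ 2 * (A / 2 + 1 + (A / 2 - 1) * Real.cos (2 * π * j / N))
            - 2 + 2 * Real.cos (2 * π * j / N)) +
      (if Even N then (2 * r) ^ (-A) * (-(A - 1) + (A + 1)) else 0))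
    (hQ : Q₁ = 2 * r ^ (2 - A) *
        ∑ j ∈ Finset.Icc 1 ((N - 1) / 2), u j ^ (-A) * (1 - Real.cos (2 * π * j / N)) *
          ((A - 2) / 2 * (1 + Real.cos (2 * π * j / N)) + 1))
    (hs : s₁ = (A - 2) * r ^ (1 - A) *
        ∑ j ∈ Finset.Icc 1 ((N - 1) / 2),
          Real.sin (2 * π * j / N) ^ 2 * u j ^ (-A)) :
    P₁ * Q₁ - s₁ ^ 2 > 0 ∧ P₁ + Q₁ > 0 ∧
      0 < (P₁ + Q₁ + Real.sqrt ((P₁ - Q₁) ^ 2 + 4 * s₁ ^ 2)) / 2 ∧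
      0 < (P₁ + Q₁ - Real.sqrt ((P₁ - Q₁) ^ 2 + 4 * s₁ ^ 2)) / 2 := by
  have hN0 : (0:ℝ) < N := by
    have : 0 < N := by omega
    exact_mod_cast this
  have hupos : ∀ j : ℕ, 1 ≤ j → j < N → 0 < u j := by
    intro j h1 h2
    rw [hu]
    have hj : (0:ℝ) < j := by
      have : 0 < j := by omega
      exact_mod_cast this
    have hjN : (j:ℝ) < N := by exact_mod_cast h2
    have : 0 < Real.sin (π * j / N) := by
      apply Real.sin_pos_of_pos_of_lt_pi
      · have := Real.pi_pos
        positivity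
      · rw [div_lt_iff₀ hN0]
        exact mul_lt_mul_of_pos_left hjN Real.pi_pos
    linarith
  have hrpos : 0 < r := by
    rw [hr]
    apply Real.rpow_pos_of_pos
    apply div_pos _ (by positivity)
    apply Finset.sum_pos
    · intro j hj
      rw [Finset.mem_Icc] at hj
      exact Real.rpow_pos_of_pos (hupos j hj.1 (by omega)) _
    · exact ⟨1, by rw [Finset.mem_Icc]; omega⟩
  have hu2 : ∀ j : ℕ, u j ^ 2 = 2 - 2 * Real.cos (2 * π * j / N) := by
    intro j
    have h : 2 * π * j / N = 2 * (π * j / N) := by ring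
    rw [hu, h, Real.cos_two_mul, mul_pow, Real.sin_sq]
    ring
  set T := ∑ j ∈ Finset.Icc 1 ((N - 1) / 2),
    u j ^ (-A) * u j ^ 2 * (1 + Real.cos (2 * π * j / N)) with hT
  set W := ∑ j ∈ Finset.Icc 1 ((N - 1) / 2), u j ^ (-A) * u j ^ 2 with hW
  have hWpos : 0 < W := by
    apply Finset.sum_pos
    · intro j hj
      rw [Finset.mem_Icc] at hj
      have h := hupos j hj.1 (by omega)
      have := Real.rpow_pos_of_pos h (-A)
      positivity
    · exact ⟨1, by rw [Finset.mem_Icc]; omega⟩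
  have hTnn : 0 ≤ T := by
    apply Finset.sum_nonneg
    intro j hj
    rw [Finset.mem_Icc] at hj
    have h := hupos j hj.1 (by omega)
    have h1 := Real.rpow_pos_of_pos h (-A)
    have h2 : 0 ≤ 1 + Real.cos (2 * π * j / N) := by
      linarith [Real.neg_one_le_cos (2 * π * j / N)]
    positivity
  set B := (A - 2) / 2 * T with hB
  have hBnn : 0 ≤ B := mul_nonneg (by linarith) hTnn
  have e1 : ∑ j ∈ Finset.Icc 1 ((N - 1) / 2),
          u j ^ (-A) * (u j ^ 2 * (A / 2 + 1 + (A / 2 - 1) * Real.cos (2 * π * j / N))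
            - 2 + 2 * Real.cos (2 * π * j / N)) = B + W := by
    rw [hB, hT, hW, Finset.mul_sum, ← Finset.sum_add_distrib]
    refine Finset.sum_congr rfl fun j _ => ?_
    rw [hu2]; ring
  have e2 : ∑ j ∈ Finset.Icc 1 ((N - 1) / 2), u j ^ (-A) * (1 - Real.cos (2 * π * j / N)) *
          ((A - 2) / 2 * (1 + Real.cos (2 * π * j / N)) + 1) = (B + W) / 2 := by
    rw [hB, hT, hW, Finset.mul_sum, ← Finset.sum_add_distrib, Finset.sum_div]
    refine Finset.sum_congr rfl fun j _ => ?_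
    rw [hu2]; ring
  have e3 : ∑ j ∈ Finset.Icc 1 ((N - 1) / 2),
          Real.sin (2 * π * j / N) ^ 2 * u j ^ (-A) = T / 2 := by
    rw [hT, Finset.sum_div]
    refine Finset.sum_congr rfl fun j _ => ?_
    rw [hu2, Real.sin_sq]; ring
  have hR : 0 < r ^ (-A) := Real.rpow_pos_of_pos hrpos _
  have r2 : r ^ (2 - A) = r ^ 2 * r ^ (-A) := by
    rw [sub_eq_add_neg, Real.rpow_add hrpos, Real.rpow_two]
  have r1 : r ^ (1 - A) = r * r ^ (-A) := by
    rw [sub_eq_add_neg, Real.rpow_add hrpos, Real.rpow_one]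
  rw [e1] at hP
  rw [e2, r2] at hQ
  rw [e3, r1] at hs
  have hP' : r ^ (-A) * (B + W) ≤ P₁ := by
    have : (0:ℝ) ≤ (if Even N then (2 * r) ^ (-A) * (-(A - 1) + (A + 1)) else 0) := by
      split_ifs
      · have := Real.rpow_pos_of_pos (show 0 < 2 * r by linarith) (-A)
        apply mul_nonneg this.le; linarith
      · exact le_rfl
    linarith
  generalize r ^ (-A) = R at *
  have hQ' : Q₁ = r ^ 2 * (R * (B + W)) := by rw [hQ]; ring
  have hs' : s₁ = r * (R * B) := by rw [hs, hB]; ring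
  have hX : 0 < R * (B + W) := by positivity
  have hQpos : 0 < Q₁ := by rw [hQ']; positivity
  have hPpos : 0 < P₁ := lt_of_lt_of_le hX hP'
  have hdet : P₁ * Q₁ - s₁ ^ 2 > 0 := by
    have h1 : R * (B + W) * Q₁ ≤ P₁ * Q₁ := mul_le_mul_of_nonneg_right hP' hQpos.le
    have h2 : 0 < R * (B + W) * Q₁ - s₁ ^ 2 := by
      have : R * (B + W) * Q₁ - s₁ ^ 2 = r ^ 2 * R ^ 2 * (W * (2 * B + W)) := by
        rw [hQ', hs']; ring
      rw [this]; positivity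
    linarith
  have hlt : Real.sqrt ((P₁ - Q₁) ^ 2 + 4 * s₁ ^ 2) < P₁ + Q₁ := by
    rw [Real.sqrt_lt' (by linarith)]
    nlinarith
  have h0 := Real.sqrt_nonneg ((P₁ - Q₁) ^ 2 + 4 * s₁ ^ 2)
  exact ⟨hdet, by linarith, by linarith, by linarith⟩
end

section
/- Let N ≥ 5 be an integer. With u_j = 2 sin(πj/N), r(A) = ((∑_{j=1}^{N−1} u_j^{2−A})/(2N))^{1/A}, and for 0 ≤ i ≤ N−1 the quantities P_i(A) = r(A)^{−A}·∑_{j=1}^{⌊(N−1)/2⌋} u_j^{−A}·( u_j²·(A/2 + 1 + (A/2 − 1)cos(2πij/N)) − 2 + 2cos(2πij/N) ) + c_N(i,A) (where c_N(i,A) = (2r(A))^{−A}·((−1)^i(A−1) + (A+1)) if N is even, 0 if N is odd), Q_i(A) = 2r(A)^{2−A}·∑_{j=1}^{⌊(N−1)/2⌋} u_j^{−A}·(1 − cos(2πij/N))·(((A−2)/2)(1 + cos(2πj/N)) + 1), and s_i(A) = (A−2)·r(A)^{1−A}·∑_{j=1}^{⌊(N−1)/2⌋} sin(2πij/N)·sin(2πj/N)·u_j^{−A}: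 there exists a real A_N ≥ 2 such that for all A > A_N and all integers i with 2 ≤ i ≤ ⌊N/2⌋ one has P_i(A)·Q_i(A) − s_i(A)² < 0. Consequently, for A > A_N each Hessian block E_i with 2 ≤ i ≤ N−2, i ≠ N−i only counted per block, has one strictly negative and one strictly positive eigenvalue, and the Morse index of the equal-mass regular N-gon is N − 3. -/
open Real Finset

lemma aux_exp (ρ : ℝ) (h0 : 0 < ρ) (h1 : ρ < 1) (n : ℕ) :
    Filter.Tendsto (fun A : ℝ => A ^ n * ρ ^ A) Filter.atTop (nhds 0) := by
  have hb : 0 < -Real.log ρ := by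
    have := Real.log_neg h0 h1
    linarith
  have h := tendsto_rpow_mul_exp_neg_mul_atTop_nhds_zero (n : ℝ) (-Real.log ρ) hb
  refine h.congr fun A => ?_
  rw [Real.rpow_natCast, Real.rpow_def_of_pos h0]
  simp

lemma aux_term (ρ α β : ℝ) (h0 : 0 < ρ) (h1 : ρ < 1) :
    Filter.Tendsto (fun A : ℝ => A ^ 2 * (ρ ^ A * (α * A + β))) Filter.atTop (nhds 0) := by
  have h := ((aux_exp ρ h0 h1 3).const_mul α).add ((aux_exp ρ h0 h1 2).const_mul β)
  simp only [mul_zero, add_zero] at h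
  refine h.congr fun A => ?_
  ring

lemma aux_tail (S : Finset ℕ) (ρ α β : ℕ → ℝ) (h0 : ∀ j ∈ S, 0 < ρ j) (h1 : ∀ j ∈ S, ρ j < 1) :
    Filter.Tendsto (fun A : ℝ => A ^ 2 * ∑ j ∈ S, ρ j ^ A * (α j * A + β j))
      Filter.atTop (nhds 0) := by
  have h := tendsto_finsetSum S (fun j hj => aux_term (ρ j) (α j) (β j) (h0 j hj) (h1 j hj))
  simp only [Finset.sum_const_zero] at h
  refine h.congr fun A => ?_
  rw [Finset.mul_sum]

lemma aux_lim_s14 (e1 e2 e3 : ℝ → ℝ) (a b c d s : ℝ) (hs : 2 * a * c = s ^ 2)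
    (h1 : Filter.Tendsto (fun A : ℝ => A ^ 2 * e1 A) Filter.atTop (nhds 0))
    (h2 : Filter.Tendsto (fun A : ℝ => A ^ 2 * e2 A) Filter.atTop (nhds 0))
    (h3 : Filter.Tendsto (fun A : ℝ => A ^ 2 * e3 A) Filter.atTop (nhds 0)) :
    Filter.Tendsto (fun A : ℝ => (2 * (a * A + b + e1 A) * (c * A + d + e2 A)
      - (A - 2) ^ 2 * (s + e3 A) ^ 2) / A) Filter.atTop
      (nhds (2 * (a * d + b * c) + 4 * s ^ 2)) := by
  have ht : Filter.Tendsto (fun A : ℝ => A⁻¹) Filter.atTop (nhds 0) := tendsto_inv_atTop_zero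
  let f : ℝ × ℝ × ℝ × ℝ → ℝ := fun x =>
    2 * (a * d + b * c) + 2 * b * d * x.1 + 2 * (a + b * x.1) * x.2.2.1 * x.1 ^ 2
    + 2 * (c + d * x.1) * x.2.1 * x.1 ^ 2 + 2 * x.2.1 * x.2.2.1 * x.1 ^ 5 + 4 * s ^ 2
    - 4 * x.1 * s ^ 2 - (1 - 2 * x.1) ^ 2 * (2 * s * x.2.2.2 * x.1 + x.2.2.2 ^ 2 * x.1 ^ 3)
  have hf : Continuous f := by fun_prop
  have h := (hf.tendsto (0, 0, 0, 0)).comp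
    (ht.prodMk_nhds (h1.prodMk_nhds (h2.prodMk_nhds h3)))
  have hv : f (0, 0, 0, 0) = 2 * (a * d + b * c) + 4 * s ^ 2 := by simp [f]
  rw [hv] at h
  refine h.congr' ?_
  filter_upwards [Filter.eventually_gt_atTop 0] with A hA
  have hA' : A ≠ 0 := hA.ne'
  simp only [f, Function.comp]
  field_simp
  linear_combination (- A ^ 2) * hs

/-- the scaled determinant -/
lemma aux_core (M : ℕ) (hM : 1 ≤ M) (u k c sg sp : ℕ → ℝ) (m : ℝ) (ev : Prop) [Decidable ev]
    (hu0 : 0 < u 1) (hu2 : u 1 < 2) (hu : ∀ j, 2 ≤ j → j ≤ M → u 1 < u j)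
    (huc : u 1 ^ 2 = 2 * (1 - c 1)) (hsg : sg 1 ^ 2 = 1 - k 1 ^ 2) (hsp : sp 1 ^ 2 = 1 - c 1 ^ 2) :
    Filter.Tendsto (fun A : ℝ =>
      ((2 * (u 1 ^ A * (∑ j ∈ Finset.Icc 1 M, u j ^ (-A) * (u j ^ 2 * (A / 2 + 1 + (A / 2 - 1) * k j)
            - 2 + 2 * k j) + (if ev then (2 : ℝ) ^ (-A) * (m * (A - 1) + (A + 1)) else 0))) *
      (u 1 ^ A * ∑ j ∈ Finset.Icc 1 M, u j ^ (-A) * (1 - k j) * ((A - 2) / 2 * (1 + c j) + 1)) -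
      (A - 2) ^ 2 * (u 1 ^ A * ∑ j ∈ Finset.Icc 1 M, sg j * sp j * u j ^ (-A)) ^ 2) / A)) Filter.atTop
      (nhds (4 * (1 - k 1) * (1 - c 1 ^ 2 - c 1 + k 1))) := by
  set S := (Finset.Icc 1 M).erase 1 with hS
  have h1M : 1 ∈ Finset.Icc 1 M := by simp [hM]
  have hSj : ∀ j ∈ S, u 1 < u j := by
    intro j hj
    simp only [hS, Finset.mem_erase, Finset.mem_Icc] at hj
    exact hu j (by omega) (by omega)
  have hr0 : ∀ j ∈ S, 0 < u 1 / u j := fun j hj => div_pos hu0 (hu0.trans (hSj j hj))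
  have hr1 : ∀ j ∈ S, u 1 / u j < 1 := fun j hj =>
    (div_lt_one (hu0.trans (hSj j hj))).2 (hSj j hj)
  have hpw : ∀ A x : ℝ, 0 < x → u 1 ^ A * x ^ (-A) = (u 1 / x) ^ A := by
    intro A x hx
    rw [Real.div_rpow hu0.le hx.le, Real.rpow_neg hx.le]
    rfl
  have hone : ∀ A : ℝ, u 1 ^ A * u 1 ^ (-A) = 1 := by
    intro A
    rw [hpw A _ hu0, div_self hu0.ne', Real.one_rpow]
  have t1 := aux_tail S (fun j => u 1 / u j) (fun j => u j ^ 2 / 2 * (1 + k j))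
    (fun j => (u j ^ 2 - 2) * (1 - k j)) hr0 hr1
  have t1' := aux_term (u 1 / 2) (if ev then m + 1 else 0) (if ev then 1 - m else 0)
    (by positivity) (by linarith)
  have t2 := aux_tail S (fun j => u 1 / u j) (fun j => (1 - k j) * (1 + c j) / 2)
    (fun j => -(1 - k j) * c j) hr0 hr1
  have t3 := aux_tail S (fun j => u 1 / u j) (fun j => 0) (fun j => sg j * sp j) hr0 hr1
  have t11 := t1.add t1'
  simp only [add_zero, ← mul_add] at t11
  have h := aux_lim_s14 _ _ _ ((1 - c 1) * (1 + k 1)) (-2 * c 1 * (1 - k 1))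
    ((1 - k 1) * (1 + c 1) / 2) (-(1 - k 1) * c 1) (sg 1 * sp 1)
    (by rw [mul_pow, hsg, hsp]; ring) t11 t2 t3
  have hlim : 2 * ((1 - c 1) * (1 + k 1) * (-(1 - k 1) * c 1) + -2 * c 1 * (1 - k 1) * ((1 - k 1) * (1 + c 1) / 2)) + 4 * (sg 1 * sp 1) ^ 2 = 4 * (1 - k 1) * (1 - c 1 ^ 2 - c 1 + k 1) := by
    rw [mul_pow, hsg, hsp]; ring
  rw [hlim] at h
  refine h.congr fun A => ?_
  have E1 : u 1 ^ A * (∑ j ∈ Finset.Icc 1 M, u j ^ (-A) * (u j ^ 2 * (A / 2 + 1 + (A / 2 - 1) * k j)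
            - 2 + 2 * k j) + (if ev then (2 : ℝ) ^ (-A) * (m * (A - 1) + (A + 1)) else 0)) =
      (1 - c 1) * (1 + k 1) * A + -2 * c 1 * (1 - k 1) +
        (∑ j ∈ S, (u 1 / u j) ^ A * (u j ^ 2 / 2 * (1 + k j) * A + (u j ^ 2 - 2) * (1 - k j)) +
          (u 1 / 2) ^ A * ((if ev then m + 1 else 0) * A + (if ev then 1 - m else 0))) := by
    rw [mul_add, ← Finset.add_sum_erase _ _ h1M, mul_add, ← mul_assoc, hone, ← hS, Finset.mul_sum,
      huc, add_assoc]
    congr 1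
    · ring
    · congr 1
      · refine Finset.sum_congr rfl fun j hj => ?_
        rw [← mul_assoc, hpw A _ (hu0.trans (hSj j hj))]
        ring
      · rw [← hpw A 2 two_pos]
        split_ifs <;> ring
  have E2 : u 1 ^ A * ∑ j ∈ Finset.Icc 1 M, u j ^ (-A) * (1 - k j) * ((A - 2) / 2 * (1 + c j) + 1) =
      (1 - k 1) * (1 + c 1) / 2 * A + -(1 - k 1) * c 1 +
        ∑ j ∈ S, (u 1 / u j) ^ A * ((1 - k j) * (1 + c j) / 2 * A + -(1 - k j) * c j) := by
    rw [← Finset.add_sum_erase _ _ h1M, mul_add, ← mul_assoc, ← mul_assoc, hone, ← hS,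
      Finset.mul_sum]
    congr 1
    · ring
    · refine Finset.sum_congr rfl fun j hj => ?_
      rw [← mul_assoc, ← mul_assoc, hpw A _ (hu0.trans (hSj j hj))]
      ring
  have E3 : u 1 ^ A * ∑ j ∈ Finset.Icc 1 M, sg j * sp j * u j ^ (-A) =
      sg 1 * sp 1 + ∑ j ∈ S, (u 1 / u j) ^ A * (0 * A + sg j * sp j) := by
    rw [← Finset.add_sum_erase _ _ h1M, mul_add, mul_left_comm, hone, ← hS, Finset.mul_sum]
    congr 1
    · ring
    · refine Finset.sum_congr rfl fun j hj => ?_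
      rw [mul_left_comm, hpw A _ (hu0.trans (hSj j hj))]
      ring
  rw [E1, E2, E3]

lemma aux_eig_neg (p q s : ℝ) (h : p * q - s ^ 2 < 0) :
    (p + q - Real.sqrt ((p - q) ^ 2 + 4 * s ^ 2)) / 2 < 0 ∧
    0 < (p + q + Real.sqrt ((p - q) ^ 2 + 4 * s ^ 2)) / 2 := by
  have : |p + q| < Real.sqrt ((p - q) ^ 2 + 4 * s ^ 2) := by
    apply Real.lt_sqrt_of_sq_lt
    rw [sq_abs]; nlinarith
  have := abs_lt.1 this
  constructor <;> linarith [this.1, this.2]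

lemma aux_eig_pos (p q s : ℝ) (hpq : 0 ≤ p + q) (h : 0 ≤ p * q - s ^ 2) :
    ¬ (p + q - Real.sqrt ((p - q) ^ 2 + 4 * s ^ 2)) / 2 < 0 ∧
    ¬ (p + q + Real.sqrt ((p - q) ^ 2 + 4 * s ^ 2)) / 2 < 0 := by
  have h1 : Real.sqrt ((p - q) ^ 2 + 4 * s ^ 2) ≤ p + q := by
    apply Real.sqrt_le_iff.2 ⟨hpq, by nlinarith⟩
  have h2 := Real.sqrt_nonneg ((p - q) ^ 2 + 4 * s ^ 2)
  constructor <;> linarith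

lemma aux_count (N : ℕ) (hN : 5 ≤ N) (a b : ℕ → Prop) [DecidablePred a] [DecidablePred b]
    (hmid : ∀ i, 2 ≤ i → i ≤ N - 2 → a i ∧ ¬ b i)
    (hend : ∀ i, i = 0 ∨ i = 1 ∨ i = N - 1 → ¬ a i ∧ ¬ b i) :
    ∑ i ∈ Finset.range N, ((if a i then 1 else 0) + (if b i then 1 else 0)) = N - 3 := by
  have : ∀ i ∈ Finset.range N, ((if a i then 1 else 0) + (if b i then 1 else 0)) =
      if i ∈ Finset.Icc 2 (N - 2) then 1 else 0 := by
    intro i hi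
    rw [Finset.mem_range] at hi
    by_cases h : 2 ≤ i ∧ i ≤ N - 2
    · have := hmid i h.1 h.2
      simp [this.1, this.2, h.1, h.2]
    · have := hend i (by omega)
      simp only [this.1, this.2, Finset.mem_Icc, h, if_false]
  rw [Finset.sum_congr rfl this, Finset.sum_ite_mem,
    Finset.inter_eq_right.2 (by intro i; simp only [Finset.mem_Icc, Finset.mem_range]; omega)]
  simp only [Finset.sum_const, Nat.card_Icc, smul_eq_mul, mul_one]
  omega

lemma aux_cos_le (N i : ℕ) (hN : 5 ≤ N) (h2 : 2 ≤ i) (hi : i ≤ N - 2) :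
    Real.cos (2 * π * i / N) ≤ Real.cos (2 * (2 * π / N)) := by
  have hNR : (0 : ℝ) < N := by positivity
  have hN5 : (5 : ℝ) ≤ N := by exact_mod_cast hN
  have hp := Real.pi_pos
  have h2R : (2 : ℝ) ≤ i := by exact_mod_cast h2
  have hiR : (i : ℝ) + 2 ≤ N := by
    have : i + 2 ≤ N := by omega
    exact_mod_cast this
  by_cases h : 2 * i ≤ N
  · have hR : 2 * (i : ℝ) ≤ N := by exact_mod_cast h
    apply Real.cos_le_cos_of_nonneg_of_le_pi
    · positivity
    · rw [div_le_iff₀ hNR]; nlinarith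
    · rw [← mul_div_assoc, div_le_div_iff_of_pos_right hNR]; nlinarith
  · have hR : (N : ℝ) ≤ 2 * i := by
      have : N ≤ 2 * i := by omega
      exact_mod_cast this
    rw [← Real.cos_two_pi_sub (2 * π * i / N)]
    have he : 2 * π - 2 * π * i / N = 2 * π * (N - i) / N := by field_simp
    rw [he]
    apply Real.cos_le_cos_of_nonneg_of_le_pi
    · positivity
    · rw [div_le_iff₀ hNR]; nlinarith
    · rw [← mul_div_assoc, div_le_div_iff_of_pos_right hNR]; nlinarith

/-- For `N ≥ 5`, with the block entries `P A i`, `Q A i`, `s A i` of the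
diagonalized Hessian of the equal-mass regular `N`-gon at exponent `A`, there is `A_N ≥ 2`
such that for all `A > A_N`: the block determinant `P·Q - s²` is negative for
`2 ≤ i ≤ ⌊N/2⌋`, each block with `2 ≤ i ≤ N-2` has one strictly negative and one strictly
positive eigenvalue, and the total number of negative eigenvalues (the Morse index of the
regular `N`-gon) is `N - 3`. -/
theorem polygon_morse_index_large_A
    (N : ℕ) (hN : 5 ≤ N)
    (u : ℕ → ℝ) (hu : ∀ j, u j = 2 * Real.sin (π * j / N))
    (r : ℝ → ℝ)
    (hr : ∀ A : ℝ, r A = ((∑ j ∈ Finset.Icc 1 (N - 1), u j ^ (2 - A)) / (2 * N)) ^ (1 / A))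
    (P Q s : ℝ → ℕ → ℝ)
    (hP : ∀ A : ℝ, ∀ i : ℕ, P A i = r A ^ (-A) *
        ∑ j ∈ Finset.Icc 1 ((N - 1) / 2),
          u j ^ (-A) * (u j ^ 2 * (A / 2 + 1 + (A / 2 - 1) * Real.cos (2 * π * i * j / N))
            - 2 + 2 * Real.cos (2 * π * i * j / N)) +
      (if Even N then (2 * r A) ^ (-A) * ((-1 : ℝ) ^ i * (A - 1) + (A + 1)) else 0))
    (hQ : ∀ A : ℝ, ∀ i : ℕ, Q A i = 2 * r A ^ (2 - A) *
        ∑ j ∈ Finset.Icc 1 ((N - 1) / 2),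
          u j ^ (-A) * (1 - Real.cos (2 * π * i * j / N)) *
            ((A - 2) / 2 * (1 + Real.cos (2 * π * j / N)) + 1))
    (hs : ∀ A : ℝ, ∀ i : ℕ, s A i = (A - 2) * r A ^ (1 - A) *
        ∑ j ∈ Finset.Icc 1 ((N - 1) / 2),
          Real.sin (2 * π * i * j / N) * Real.sin (2 * π * j / N) * u j ^ (-A)) :
    ∃ A_N : ℝ, 2 ≤ A_N ∧ ∀ A : ℝ, A_N < A →
      (∀ i : ℕ, 2 ≤ i → i ≤ N / 2 → P A i * Q A i - s A i ^ 2 < 0) ∧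
      (∀ i : ℕ, 2 ≤ i → i ≤ N - 2 →
        (P A i + Q A i - Real.sqrt ((P A i - Q A i) ^ 2 + 4 * s A i ^ 2)) / 2 < 0 ∧
        0 < (P A i + Q A i + Real.sqrt ((P A i - Q A i) ^ 2 + 4 * s A i ^ 2)) / 2) ∧
      (∑ i ∈ Finset.range N,
        ((if (P A i + Q A i - Real.sqrt ((P A i - Q A i) ^ 2 + 4 * s A i ^ 2)) / 2 < 0
            then 1 else 0) +
          (if (P A i + Q A i + Real.sqrt ((P A i - Q A i) ^ 2 + 4 * s A i ^ 2)) / 2 < 0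
            then 1 else 0))) = N - 3 := by
  have hNR : (0 : ℝ) < N := by positivity
  have hN5 : (5 : ℝ) ≤ N := by exact_mod_cast hN
  have hp := Real.pi_pos
  have hM1 : 1 ≤ (N - 1) / 2 := by omega
  have hupos : ∀ j, 1 ≤ j → j ≤ N - 1 → 0 < u j := by
    intro j h1 h2
    have h1R : (1 : ℝ) ≤ j := by exact_mod_cast h1
    have h2R : (j : ℝ) < N := by
      have : j < N := by omega
      exact_mod_cast this
    rw [hu]
    have : 0 < Real.sin (π * j / N) := by
      apply Real.sin_pos_of_pos_of_lt_pi
      · positivity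
      · rw [div_lt_iff₀ hNR]; nlinarith
    linarith
  have hu0 : 0 < u 1 := hupos 1 le_rfl (by omega)
  have hphi : π * ((1 : ℕ) : ℝ) / N < π / 2 := by
    rw [div_lt_div_iff₀ hNR two_pos]; push_cast; nlinarith
  have humono : ∀ x : ℝ, π * ((1 : ℕ) : ℝ) / N < x → x ≤ π / 2 → u 1 < 2 * Real.sin x := by
    intro x h1 h2
    rw [hu]
    have : Real.sin (π * ((1 : ℕ) : ℝ) / N) < Real.sin x := by
      apply Real.sin_lt_sin_of_lt_of_le_pi_div_two _ h2 h1
      have : 0 ≤ π * ((1 : ℕ) : ℝ) / N := by positivity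
      linarith
    linarith
  have hu2 : u 1 < 2 := by
    have := humono (π / 2) hphi le_rfl
    rwa [Real.sin_pi_div_two, mul_one] at this
  have huj : ∀ j, 2 ≤ j → j ≤ (N - 1) / 2 → u 1 < u j := by
    intro j h1 h2
    have h1R : (2 : ℝ) ≤ j := by exact_mod_cast h1
    have h2R : 2 * (j : ℝ) ≤ N := by
      have : 2 * j ≤ N := by omega
      exact_mod_cast this
    rw [hu j]
    apply humono
    · rw [div_lt_div_iff_of_pos_right hNR]; push_cast; nlinarith
    · rw [div_le_div_iff₀ hNR two_pos]; nlinarith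
  have hrpos : ∀ A, 0 < r A := by
    intro A
    rw [hr]
    apply Real.rpow_pos_of_pos
    apply div_pos _ (by positivity)
    apply Finset.sum_pos
    · intro j hj
      rw [Finset.mem_Icc] at hj
      exact Real.rpow_pos_of_pos (hupos j hj.1 hj.2) _
    · exact ⟨1, by rw [Finset.mem_Icc]; omega⟩
  set c : ℝ := Real.cos (2 * π / N) with hc
  have hphi2 : 2 * π / N < π / 2 := by
    rw [div_lt_div_iff₀ hNR two_pos]; nlinarith
  have hphi0 : 0 < 2 * π / N := by positivity
  have hc0 : 0 < c := Real.cos_pos_of_mem_Ioo ⟨by linarith, hphi2⟩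
  have hc1 : c < 1 := by
    have := Real.cos_lt_cos_of_nonneg_of_le_pi_div_two le_rfl hphi2.le hphi0
    rwa [Real.cos_zero] at this
  -- core: determinant formula
  let F : ℕ → ℝ → ℝ := fun i A =>
      ((2 * (u 1 ^ A * (∑ j ∈ Finset.Icc 1 ((N - 1) / 2), u j ^ (-A) * (u j ^ 2 * (A / 2 + 1 + (A / 2 - 1) * Real.cos (2 * π * i * j / N))
            - 2 + 2 * Real.cos (2 * π * i * j / N)) + (if Even N then (2 : ℝ) ^ (-A) * ((-1 : ℝ) ^ i * (A - 1) + (A + 1)) else 0))) *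
      (u 1 ^ A * ∑ j ∈ Finset.Icc 1 ((N - 1) / 2), u j ^ (-A) * (1 - Real.cos (2 * π * i * j / N)) * ((A - 2) / 2 * (1 + Real.cos (2 * π * j / N)) + 1)) -
      (A - 2) ^ 2 * (u 1 ^ A * ∑ j ∈ Finset.Icc 1 ((N - 1) / 2), Real.sin (2 * π * i * j / N) * Real.sin (2 * π * j / N) * u j ^ (-A)) ^ 2) / A)
  have hF : ∀ i : ℕ, Filter.Tendsto (F i) Filter.atTop
      (nhds (4 * (1 - Real.cos (2 * π * i / N)) * (1 - c ^ 2 - c + Real.cos (2 * π * i / N)))) := by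
    intro i
    have h := aux_core ((N - 1) / 2) hM1 u (fun j => Real.cos (2 * π * i * j / N))
      (fun j => Real.cos (2 * π * j / N)) (fun j => Real.sin (2 * π * i * j / N))
      (fun j => Real.sin (2 * π * j / N)) ((-1 : ℝ) ^ i) (Even N) hu0 hu2 huj
      (by
        have : 2 * π * ((1 : ℕ) : ℝ) / N = 2 * (π * ((1 : ℕ) : ℝ) / N) := by ring
        simp only [this]
        rw [hu, Real.cos_two_mul, mul_pow, Real.sin_sq]; ring)
      (Real.sin_sq _) (Real.sin_sq _)
    simp only [Nat.cast_one, mul_one, ← hc] at h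
    exact h
  have hdet : ∀ i : ℕ, ∀ A : ℝ, 0 < A → ∃ K : ℝ, 0 < K ∧ P A i * Q A i - s A i ^ 2 = K * F i A := by
    intro i A hA
    have hR := hrpos A
    have hU : 0 < u 1 ^ A := Real.rpow_pos_of_pos hu0 A
    have hRA : 0 < r A ^ (-A) := Real.rpow_pos_of_pos hR _
    refine ⟨(r A ^ (-A)) ^ 2 * r A ^ 2 * A / (u 1 ^ A) ^ 2, by positivity, ?_⟩
    have e2 : r A ^ (2 - A) = r A ^ 2 * r A ^ (-A) := by
      rw [sub_eq_add_neg, Real.rpow_add hR]; norm_num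
    have e1 : r A ^ (1 - A) = r A * r A ^ (-A) := by
      rw [sub_eq_add_neg, Real.rpow_add hR]; norm_num
    have e0 : (2 * r A) ^ (-A) = (2 : ℝ) ^ (-A) * r A ^ (-A) := Real.mul_rpow (by norm_num) hR.le
    have hite : (if Even N then (2 * r A) ^ (-A) * ((-1 : ℝ) ^ i * (A - 1) + (A + 1)) else 0) =
        r A ^ (-A) * (if Even N then (2 : ℝ) ^ (-A) * ((-1 : ℝ) ^ i * (A - 1) + (A + 1)) else 0) := by
      rw [e0]; split_ifs <;> ring
    rw [hP, hQ, hs, hite, e1, e2]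
    simp only [F]
    generalize (if Even N then (2 : ℝ) ^ (-A) * ((-1 : ℝ) ^ i * (A - 1) + (A + 1)) else 0) = X0
    generalize ∑ j ∈ Finset.Icc 1 ((N - 1) / 2), u j ^ (-A) * (u j ^ 2 * (A / 2 + 1 + (A / 2 - 1) * Real.cos (2 * π * i * j / N))
            - 2 + 2 * Real.cos (2 * π * i * j / N)) = X1
    generalize ∑ j ∈ Finset.Icc 1 ((N - 1) / 2), u j ^ (-A) * (1 - Real.cos (2 * π * i * j / N)) * ((A - 2) / 2 * (1 + Real.cos (2 * π * j / N)) + 1) = X2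
    generalize ∑ j ∈ Finset.Icc 1 ((N - 1) / 2), Real.sin (2 * π * i * j / N) * Real.sin (2 * π * j / N) * u j ^ (-A) = X3
    field_simp
  have hneg : ∀ i : ℕ, 2 ≤ i → i ≤ N - 2 → ∀ᶠ A in Filter.atTop, F i A < 0 := by
    intro i h2 hi
    refine (hF i).eventually_lt_const ?_
    have hk := aux_cos_le N i hN h2 hi
    rw [Real.cos_two_mul, ← hc] at hk
    have hk1 : Real.cos (2 * π * i / N) < 1 := by nlinarith
    apply mul_neg_of_pos_of_neg
    · linarith
    · nlinarith
  have hcos1 : ∀ i : ℕ, i = 1 ∨ i = N - 1 → Real.cos (2 * π * i / N) = c := by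
    rintro i (rfl | rfl)
    · simp [hc]
    · rw [hc, ← Real.cos_two_pi_sub (2 * π / N)]
      congr 1
      rw [Nat.cast_sub (by omega)]
      push_cast
      field_simp
  have hposi : ∀ i : ℕ, i = 1 ∨ i = N - 1 → ∀ᶠ A in Filter.atTop, 0 < F i A := by
    intro i hi
    refine (hF i).eventually_const_lt ?_
    rw [hcos1 i hi]
    apply mul_pos
    · linarith
    · nlinarith
  have hall : ∀ᶠ A in Filter.atTop, ∀ i ∈ Finset.range N,
      (2 ≤ i → i ≤ N - 2 → F i A < 0) ∧ (i = 1 ∨ i = N - 1 → 0 < F i A) := by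
    rw [Filter.eventually_all_finset]
    intro i _
    refine Filter.Eventually.and ?_ ?_
    · by_cases h : 2 ≤ i ∧ i ≤ N - 2
      · filter_upwards [hneg i h.1 h.2] with A hA _ _ using hA
      · exact Filter.Eventually.of_forall fun A h1 h2 => absurd ⟨h1, h2⟩ h
    · by_cases h : i = 1 ∨ i = N - 1
      · filter_upwards [hposi i h] with A hA _ using hA
      · exact Filter.Eventually.of_forall fun A h1 => absurd h1 h
  obtain ⟨A0, hA0⟩ := Filter.eventually_atTop.1 hall
  refine ⟨max A0 2, le_max_right _ _, fun A hA => ?_⟩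
  have hA2 : 2 < A := (le_max_right _ _).trans_lt hA
  have hA00 : A0 ≤ A := ((le_max_left _ _).trans_lt hA).le
  have hall' := hA0 A hA00
  have hD : ∀ i : ℕ, 2 ≤ i → i ≤ N - 2 → P A i * Q A i - s A i ^ 2 < 0 := by
    intro i h2 hi
    obtain ⟨K, hK, he⟩ := hdet i A (by linarith)
    rw [he]
    exact mul_neg_of_pos_of_neg hK ((hall' i (by rw [Finset.mem_range]; omega)).1 h2 hi)
  refine ⟨fun i h2 hi => hD i h2 (by omega), fun i h2 hi => aux_eig_neg _ _ _ (hD i h2 hi), ?_⟩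
  have hRA : 0 < r A ^ (-A) := Real.rpow_pos_of_pos (hrpos A) _
  have hupos' : ∀ j ∈ Finset.Icc 1 ((N - 1) / 2), 0 < u j ^ (-A) := by
    intro j hj
    rw [Finset.mem_Icc] at hj
    exact Real.rpow_pos_of_pos (hupos j hj.1 (by omega)) _
  apply aux_count N hN
  · intro i h2 hi
    have := aux_eig_neg _ _ _ (hD i h2 hi)
    exact ⟨this.1, not_lt.2 this.2.le⟩
  · rintro i (rfl | hi)
    · have hQ0 : Q A 0 = 0 := by rw [hQ]; simp
      have hs0 : s A 0 = 0 := by rw [hs]; simp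
      have hP0 : 0 ≤ P A 0 := by
        rw [hP]
        apply add_nonneg
        · apply mul_nonneg hRA.le
          apply Finset.sum_nonneg
          intro j hj
          apply mul_nonneg (hupos' j hj).le
          have : u j ^ 2 * (A / 2 + 1 + (A / 2 - 1) * Real.cos (2 * π * ((0 : ℕ) : ℝ) * j / N)) - 2 +
              2 * Real.cos (2 * π * ((0 : ℕ) : ℝ) * j / N) = u j ^ 2 * A := by
            simp
          rw [this]
          have : 0 < A := by linarith
          positivity
        · split_ifs
          · apply mul_nonneg
            · exact Real.rpow_nonneg (by linarith [hrpos A]) _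
            · simp; linarith
          · exact le_rfl
      apply aux_eig_pos
      · rw [hQ0]; linarith
      · rw [hQ0, hs0]; simp
    · have hdp : 0 < P A i * Q A i - s A i ^ 2 := by
        obtain ⟨K, hK, he⟩ := hdet i A (by linarith)
        rw [he]
        exact mul_pos hK ((hall' i (by rw [Finset.mem_range]; omega)).2 hi)
      have hQp : 0 ≤ Q A i := by
        rw [hQ]
        apply mul_nonneg
        · have := Real.rpow_nonneg (hrpos A).le (2 - A)
          linarith
        · apply Finset.sum_nonneg
          intro j hj
          apply mul_nonneg
          · apply mul_nonneg (hupos' j hj).le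
            linarith [Real.cos_le_one (2 * π * i * j / N)]
          · have h1 := Real.neg_one_le_cos (2 * π * j / N)
            have : 0 ≤ (A - 2) / 2 * (1 + Real.cos (2 * π * j / N)) :=
              mul_nonneg (by linarith) (by linarith)
            linarith
      have hPp : 0 ≤ P A i := by
        by_contra hneg'
        push Not at hneg'
        nlinarith [sq_nonneg (s A i), mul_nonneg hQp (neg_nonneg.2 hneg'.le)]
      exact aux_eig_pos _ _ _ (by linarith) hdp.le
end

section
/- Let N = 7, A = 4, u_j = 2 sin(πj/7), and r = ((∑_{j=1}^{6} u_j^{−2})/14)^{1/4}. Define P_2 = r^{−4}·∑_{j=1}^{3} u_j^{−4}·( u_j²·(3 + cos(4πj/7)) − 2 + 2cos(4πj/7) ), Q_2 = 2r^{−2}·∑_{j=1}^{3} u_j^{−4}·(1 − cos(4πj/7))·( (1 + cos(2πj/7)) + 1 ), and s_2 = 2r^{−3}·∑_{j=1}^{3} sin(4πj/7)·sin(2πj/7)·u_j^{−4}. Then P_2 = 7/4, Q_2 = sqrt(4375/8), s_2² = sqrt(214375/128), and hence P_2·Q_2 − s_2² = 0; i.e. the smaller eigenvalue λ_{(7,2,−)}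 = (P_2 + Q_2 − sqrt((P_2 − Q_2)² + 4 s_2²))/2 of the i = 2 Hessian block of the equal-mass regular heptagon at exponent A = 4 is exactly 0. -/
open Real Finset

lemma hepta_cubic (x : ℝ) (j : ℕ) (hx : x = Real.cos (2 * π * j / 7)) (h1 : 1 ≤ j) (h2 : j ≤ 3) :
    8 * x ^ 3 + 4 * x ^ 2 - 4 * x - 1 = 0 := by
  have hpi := Real.pi_pos
  have h1' : (1 : ℝ) ≤ j := by exact_mod_cast h1
  have h2' : (j : ℝ) ≤ 3 := by exact_mod_cast h2
  have hne : x < 1 := by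
    rw [hx, ← Real.cos_zero]
    apply Real.cos_lt_cos_of_nonneg_of_le_pi le_rfl
    · nlinarith
    · positivity
  have h43 : Real.cos (2 * (2 * (2 * π * j / 7))) = Real.cos (3 * (2 * π * j / 7)) := by
    have : 2 * (2 * (2 * π * j / 7)) = j * (2 * π) - 3 * (2 * π * j / 7) := by ring
    rw [this, Real.cos_nat_mul_two_pi_sub]
  rw [Real.cos_two_mul, Real.cos_two_mul, Real.cos_three_mul, ← hx] at h43
  have : (x - 1) * (8 * x ^ 3 + 4 * x ^ 2 - 4 * x - 1) = 0 := by linear_combination h43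
  rcases mul_eq_zero.mp this with h | h
  · linarith
  · exact h

lemma hepta_u (u x : ℝ) (j : ℕ) (hu : u = 2 * Real.sin (π * j / 7))
    (hx : x = Real.cos (2 * π * j / 7)) (h1 : 1 ≤ j) (h2 : j ≤ 3) :
    u ^ (-2 : ℤ) = (4 * x ^ 2 + 6 * x + 4) / 7 ∧
    u ^ (-4 : ℤ) * (u ^ 2 * (3 + Real.cos (4 * π * j / 7))
            - 2 + 2 * Real.cos (4 * π * j / 7)) = - x ∧
    u ^ (-4 : ℤ) * (1 - Real.cos (4 * π * j / 7)) *
            ((1 + Real.cos (2 * π * j / 7)) + 1) = 10/7 + 65/14 * x + 24/7 * x^2 ∧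
    Real.sin (4 * π * j / 7) * Real.sin (2 * π * j / 7) * u ^ (-4 : ℤ)
      = 1/7 + 17/14 * x + 8/7 * x^2 := by
  have hc := hepta_cubic x j hx h1 h2
  have hu2 : u ^ 2 = 2 - 2 * x := by
    have : 2 * π * j / 7 = 2 * (π * j / 7) := by ring
    rw [hx, hu, this, Real.cos_two_mul]
    linear_combination 4 * Real.sin_sq_add_cos_sq (π * j / 7)
  have hw : (u ^ 2) * ((4 * x ^ 2 + 6 * x + 4) / 7) = 1 := by
    rw [hu2]; linear_combination (-1/7) * hc
  have hm2 : u ^ (-2 : ℤ) = (4 * x ^ 2 + 6 * x + 4) / 7 := by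
    rw [zpow_neg]
    exact inv_eq_of_mul_eq_one_right hw
  have hm4 : u ^ (-4 : ℤ) = ((4 * x ^ 2 + 6 * x + 4) / 7) ^ 2 := by
    rw [← hm2, ← zpow_natCast, ← zpow_mul]; norm_num
  have e4 : 4 * π * j / 7 = 2 * (2 * π * j / 7) := by ring
  have hs : Real.sin (2 * π * j / 7) ^ 2 = 1 - x ^ 2 := by
    rw [hx, Real.sin_sq]
  refine ⟨hm2, ?_, ?_, ?_⟩
  · rw [hm4, hu2, e4, Real.cos_two_mul, ← hx]
    linear_combination ((-8/49)*x^4 + (-4/49)*x^3 + (4/49)*x^2 + (15/49)*x) * hc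
  · rw [hm4, e4, Real.cos_two_mul, ← hx]
    linear_combination ((-4/49)*x^4 + (-18/49)*x^3 + (-30/49)*x^2 + (-41/98)*x^1 + (6/49)) * hc
  · rw [hm4, e4, Real.sin_two_mul, ← hx]
    linear_combination ((-4/49)*x^4 + (-10/49)*x^3 + (-10/49)*x^2 + (-1/98)*x^1 + (1/7)) * hc
      + 2 * x * ((4 * x ^ 2 + 6 * x + 4) / 7) ^ 2 * hs

/-- For the equal-mass regular heptagon (`N = 7`) at exponent `A = 4`, with
`u_j = 2 sin(πj/7)` and `r = ((∑_{j=1}^{6} u_j⁻²)/14)^(1/4)`, the `i = 2` Hessian block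
entries satisfy `P₂ = 7/4`, `Q₂ = sqrt(4375/8)`, `s₂² = sqrt(214375/128)`, hence
`P₂·Q₂ - s₂² = 0` and the smaller eigenvalue `λ_{(7,2,-)}` is exactly `0`. -/
theorem heptagon_A_four_zero_eigenvalue
    (u : ℕ → ℝ) (hu : ∀ j, u j = 2 * Real.sin (π * j / 7))
    (r : ℝ) (hr : r = ((∑ j ∈ Finset.Icc 1 6, u j ^ (-2 : ℤ)) / 14) ^ ((1 : ℝ) / 4))
    (P₂ Q₂ s₂ : ℝ)
    (hP : P₂ = r ^ (-4 : ℤ) *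
        ∑ j ∈ Finset.Icc 1 3,
          u j ^ (-4 : ℤ) * (u j ^ 2 * (3 + Real.cos (4 * π * j / 7))
            - 2 + 2 * Real.cos (4 * π * j / 7)))
    (hQ : Q₂ = 2 * r ^ (-2 : ℤ) *
        ∑ j ∈ Finset.Icc 1 3,
          u j ^ (-4 : ℤ) * (1 - Real.cos (4 * π * j / 7)) *
            ((1 + Real.cos (2 * π * j / 7)) + 1))
    (hs : s₂ = 2 * r ^ (-3 : ℤ) *
        ∑ j ∈ (Finset.Icc 1 3 : Finset ℕ),
          Real.sin (4 * π * j / 7) * Real.sin (2 * π * j / 7) * u j ^ (-4 : ℤ)) :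
    P₂ = 7 / 4 ∧ Q₂ = Real.sqrt (4375 / 8) ∧ s₂ ^ 2 = Real.sqrt (214375 / 128) ∧
      P₂ * Q₂ - s₂ ^ 2 = 0 ∧
      (P₂ + Q₂ - Real.sqrt ((P₂ - Q₂) ^ 2 + 4 * s₂ ^ 2)) / 2 = 0 := by
  obtain ⟨x, hx⟩ : ∃ x, x = Real.cos (2 * π * (1 : ℕ) / 7) := ⟨_, rfl⟩
  obtain ⟨y, hy⟩ : ∃ y, y = Real.cos (2 * π * (2 : ℕ) / 7) := ⟨_, rfl⟩
  obtain ⟨z, hz⟩ : ∃ z, z = Real.cos (2 * π * (3 : ℕ) / 7) := ⟨_, rfl⟩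
  have hc := hepta_cubic x 1 hx (by norm_num) (by norm_num)
  have hyx : y = 2 * x ^ 2 - 1 := by
    rw [hx, ← Real.cos_two_mul, hy]; congr 1; push_cast; ring
  have hzx : z = 4 * x ^ 3 - 3 * x := by
    rw [hx, ← Real.cos_three_mul, hz]; congr 1; push_cast; ring
  have hzx' : z = 1 / 2 - x - 2 * x ^ 2 := by linear_combination hzx + hc / 2
  have S1 : x + y + z = -1 / 2 := by rw [hyx, hzx']; ring
  have S2 : x ^ 2 + y ^ 2 + z ^ 2 = 5 / 4 := by
    rw [hyx, hzx']; linear_combination x * hc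
  obtain ⟨a1, b1, c1, d1⟩ := hepta_u (u 1) x 1 (hu 1) hx (by norm_num) (by norm_num)
  obtain ⟨a2, b2, c2, d2⟩ := hepta_u (u 2) y 2 (hu 2) hy (by norm_num) (by norm_num)
  obtain ⟨a3, b3, c3, d3⟩ := hepta_u (u 3) z 3 (hu 3) hz (by norm_num) (by norm_num)
  have h4 : u 4 = u 3 := by
    rw [hu, hu, ← Real.sin_pi_sub]; congr 2; push_cast; ring
  have h5 : u 5 = u 2 := by
    rw [hu, hu, ← Real.sin_pi_sub]; congr 2; push_cast; ring
  have h6 : u 6 = u 1 := by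
    rw [hu, hu, ← Real.sin_pi_sub]; congr 2; push_cast; ring
  have i3 : Finset.Icc 1 3 = ({1, 2, 3} : Finset ℕ) := by decide
  have i6 : Finset.Icc 1 6 = ({1, 2, 3, 4, 5, 6} : Finset ℕ) := by decide
  have T3 : ∀ f : ℕ → ℝ, ∑ j ∈ Finset.Icc 1 3, f j = f 1 + f 2 + f 3 := by
    intro f; rw [i3]; simp; ring
  have T6 : ∀ f : ℕ → ℝ, ∑ j ∈ Finset.Icc 1 6, f j = f 1 + f 2 + f 3 + f 4 + f 5 + f 6 := by
    intro f; rw [i6]; simp; ring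
  rw [T6, h4, h5, h6, a1, a2, a3] at hr
  rw [T3, b1, b2, b3] at hP
  rw [T3, c1, c2, c3] at hQ
  rw [T3, d1, d2, d3] at hs
  have eP : -x + -y + -z = 1 / 2 := by linarith
  have eQ : 10/7 + 65/14 * x + 24/7 * x^2 + (10/7 + 65/14 * y + 24/7 * y^2)
      + (10/7 + 65/14 * z + 24/7 * z^2) = 25 / 4 := by linarith
  have es : 1/7 + 17/14 * x + 8/7 * x^2 + (1/7 + 17/14 * y + 8/7 * y^2)
      + (1/7 + 17/14 * z + 8/7 * z^2) = 5 / 4 := by linarith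
  have er : ((4 * x ^ 2 + 6 * x + 4) / 7 + (4 * y ^ 2 + 6 * y + 4) / 7
      + (4 * z ^ 2 + 6 * z + 4) / 7 + (4 * z ^ 2 + 6 * z + 4) / 7
      + (4 * y ^ 2 + 6 * y + 4) / 7 + (4 * x ^ 2 + 6 * x + 4) / 7) / 14 = 2 / 7 := by linarith
  rw [er] at hr
  rw [eP] at hP
  rw [eQ] at hQ
  rw [es] at hs
  have hr0 : 0 < r := by rw [hr]; positivity
  have hr4 : r ^ 4 = 2 / 7 := by
    rw [hr, ← Real.rpow_natCast, ← Real.rpow_mul (by norm_num)]; norm_num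
  have n4 : r ^ (-4 : ℤ) = 7 / 2 := by
    rw [zpow_neg, show r ^ (4 : ℤ) = r ^ 4 from by norm_cast, hr4]; norm_num
  obtain ⟨t, ht⟩ : ∃ t, t = r ^ (-2 : ℤ) := ⟨_, rfl⟩
  have ht0 : 0 < t := by rw [ht]; positivity
  have ht2 : t ^ 2 = 7 / 2 := by
    rw [← n4, ht, ← zpow_natCast, ← zpow_mul]; norm_num
  have n3 : (r ^ (-3 : ℤ)) ^ 2 = 7 / 2 * t := by
    rw [← n4, ht, ← zpow_natCast, ← zpow_mul, ← zpow_add₀ hr0.ne']; norm_num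
  have fP : P₂ = 7 / 4 := by rw [hP, n4]; norm_num
  have fQ : Q₂ = 25 / 2 * t := by rw [hQ, ← ht]; ring
  have fs : s₂ ^ 2 = 175 / 8 * t := by
    rw [hs]; linear_combination (25 / 4) * n3
  have hdet : P₂ * Q₂ - s₂ ^ 2 = 0 := by rw [fP, fQ, fs]; ring
  refine ⟨fP, ?_, ?_, hdet, ?_⟩
  · rw [fQ]; symm
    rw [Real.sqrt_eq_iff_mul_self_eq (by norm_num) (by positivity)]
    linear_combination (-625 / 4) * ht2
  · rw [fs]; symm
    rw [Real.sqrt_eq_iff_mul_self_eq (by norm_num) (by positivity)]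
    linear_combination -(175 / 8) ^ 2 * ht2
  · have : (P₂ - Q₂) ^ 2 + 4 * s₂ ^ 2 = (P₂ + Q₂) ^ 2 := by linear_combination -4 * hdet
    rw [this, Real.sqrt_sq (by rw [fP, fQ]; positivity)]
    ring
end

section
/- Let N ≥ 2 be an integer, A > 2 a real number, m_1,…,m_N > 0 positive masses with M = ∑_{k} m_k, and define f on configurations q = (q_1,…,q_N) of N distinct points in ℝ² by f(q) = (M/2)·∑_{k} m_k|q_k|² + (1/(A−2))·∑_{k<l} m_k m_l |q_k − q_l|^{2−A}. Then there is exactly one collinear configuration of the form q_k = (x_k, 0) with x_1 < x_2 < ⋯ < x_N that is a critical point of f, and at this configuration the Hessian quadratic form of f on (ℝ²)^N ≅ ℝ^{2N} has a maximal negative-definite subspace of dimension exactly N − 2 (i.e. the planar Morse index of this collinear central configuration is N − 2). -/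
open Real Finset

/-- The Morse index of `f` at `q`: the maximal dimension of a linear subspace on which the
Hessian quadratic form `v ↦ D²f(q)(v,v)` of `f` at `q` is negative definite. -/
noncomputable def morseIndex {E : Type*} [NormedAddCommGroup E] [NormedSpace ℝ E]
    (f : E → ℝ) (q : E) : ℕ :=
  sSup {n : ℕ | ∃ V : Submodule ℝ E, Module.finrank ℝ V = n ∧
    ∀ v ∈ V, v ≠ 0 → fderiv ℝ (fderiv ℝ f) q v v < 0}


lemma aux_pos (d e : ℂ) (t : ℝ) (h : d + t * e ≠ 0) :
    0 < (d.re + t * e.re)^2 + (d.im + t * e.im)^2 := by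
  have := Complex.normSq_pos.2 h
  rw [Complex.normSq_apply] at this
  simp at this
  nlinarith

lemma aux_norm (A : ℝ) (d e : ℂ) (t : ℝ) :
    ‖d + t * e‖ ^ (2 - A) = ((d.re + t * e.re)^2 + (d.im + t * e.im)^2) ^ ((2 - A)/2) := by
  have h : (d.re + t * e.re)^2 + (d.im + t * e.im)^2 = ‖d + t * e‖ ^ (2:ℝ) := by
    rw [Real.rpow_two, ← Complex.normSq_eq_norm_sq, Complex.normSq_apply]
    simp
    ring
  rw [h, ← Real.rpow_mul (norm_nonneg _)]
  congr 1; ring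

lemma aux_P (d e : ℂ) (t : ℝ) :
    HasDerivAt (fun t : ℝ => (d.re + t * e.re)^2 + (d.im + t * e.im)^2)
     (2 * ((d.re + t * e.re) * e.re + (d.im + t * e.im) * e.im)) t := by
  have h1 : HasDerivAt (fun t : ℝ => d.re + t * e.re) (e.re) t := by
    simpa using ((hasDerivAt_id t).mul_const e.re).const_add d.re
  have h2 : HasDerivAt (fun t : ℝ => d.im + t * e.im) (e.im) t := by
    simpa using ((hasDerivAt_id t).mul_const e.im).const_add d.im
  refine ((h1.fun_pow 2).fun_add (h2.fun_pow 2)).congr_deriv ?_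
  simp; ring

lemma aux_d1 (A : ℝ) (d e : ℂ) (t : ℝ) (h : d + t * e ≠ 0) :
    HasDerivAt (fun t : ℝ => ‖d + t * e‖ ^ (2 - A))
     ((2 - A) * (((d.re + t * e.re) * e.re + (d.im + t * e.im) * e.im) *
       ((d.re + t * e.re)^2 + (d.im + t * e.im)^2) ^ (-A/2))) t := by
  simp_rw [aux_norm]
  convert (aux_P d e t).rpow_const (p := (2-A)/2) (Or.inl (aux_pos d e t h).ne') using 1
  rw [show (2 - A)/2 - 1 = -A/2 by ring]
  ring

lemma aux_d0 (d e : ℂ) (t : ℝ) :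
    HasDerivAt (fun t : ℝ => ‖d + t * e‖ ^ 2)
     (2 * ((d.re + t * e.re) * e.re + (d.im + t * e.im) * e.im)) t := by
  have := aux_P d e t
  convert this using 2
  rw [← Complex.normSq_eq_norm_sq, Complex.normSq_apply]
  simp
  ring

lemma aux_lin (d e : ℂ) (t : ℝ) :
    HasDerivAt (fun t : ℝ => ((d.re + t * e.re) * e.re + (d.im + t * e.im) * e.im))
     (e.re ^ 2 + e.im ^ 2) t := by
  have h1 : HasDerivAt (fun t : ℝ => d.re + t * e.re) (e.re) t := by
    simpa using ((hasDerivAt_id t).mul_const e.re).const_add d.re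
  have h2 : HasDerivAt (fun t : ℝ => d.im + t * e.im) (e.im) t := by
    simpa using ((hasDerivAt_id t).mul_const e.im).const_add d.im
  refine ((h1.mul_const e.re).fun_add (h2.mul_const e.im)).congr_deriv ?_
  ring

lemma aux_sq (d s : ℝ) : (d ^ 2) ^ (s / 2) = |d| ^ s := by
  rw [← sq_abs, ← Real.rpow_two, ← Real.rpow_mul (abs_nonneg _)]
  congr 1; ring

lemma aux_d2 (A : ℝ) (d : ℝ) (e : ℂ) (h : d ≠ 0) :
    HasDerivAt (fun t : ℝ => ((((d:ℂ).re + t * e.re) * e.re + ((d:ℂ).im + t * e.im) * e.im) *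
       (((d:ℂ).re + t * e.re)^2 + ((d:ℂ).im + t * e.im)^2) ^ (-A/2)))
     (|d| ^ (-A) * ((1 - A) * e.re ^ 2 + e.im ^ 2)) 0 := by
  have hp := aux_pos d e 0 (by simpa using h)
  have := (aux_lin (d:ℂ) e 0).fun_mul ((aux_P (d:ℂ) e 0).rpow_const (p := -A/2) (Or.inl hp.ne'))
  refine this.congr_deriv ?_
  simp only [Complex.ofReal_re, Complex.ofReal_im, zero_mul, add_zero, ne_eq, OfNat.ofNat_ne_zero, not_false_eq_true, zero_pow]
  have hd : 0 < d ^ 2 := by positivity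
  rw [Real.rpow_sub hd, Real.rpow_one, aux_sq]
  field_simp
  ring

lemma contDiffAt_f {N : ℕ} {A : ℝ} 
    {m : Fin N → ℝ} 
    {f : (Fin N → ℂ) → ℝ}
    (hf : ∀ q : Fin N → ℂ, (∀ k l, k ≠ l → q k ≠ q l) →
      f q = ((∑ k, m k) / 2) * ∑ k, m k * ‖q k‖ ^ 2 +
        (1 / (A - 2)) * ∑ k, ∑ l ∈ Finset.Ioi k, m k * m l * ‖q k - q l‖ ^ (2 - A))
    (q : Fin N → ℂ) (hq : ∀ k l, k ≠ l → q k ≠ q l) : 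
    (∀ᶠ p in nhds q, ∀ k l, k ≠ l → p k ≠ p l) ∧ ContDiffAt ℝ 2 f q := by
  have h1 : ∀ᶠ p in nhds q, ∀ k l, k ≠ l → p k ≠ p l := by
    simp only [Filter.eventually_all]
    intro k l hkl
    have ho : IsOpen {p : Fin N → ℂ | p k ≠ p l} := isOpen_ne_fun (continuous_apply k) (continuous_apply l)
    exact ho.mem_nhds (hq k l hkl)
  refine ⟨h1, ?_⟩
  have : f =ᶠ[nhds q] fun q => ((∑ k, m k) / 2) * ∑ k, m k * ‖q k‖ ^ 2 +
        (1 / (A - 2)) * ∑ k, ∑ l ∈ Finset.Ioi k, m k * m l * ‖q k - q l‖ ^ (2 - A) := by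
    filter_upwards [h1] with p hp using hf p hp
  refine ContDiffAt.congr_of_eventuallyEq ?_ this
  have hk : ∀ k, ContDiffAt ℝ 2 (fun q : Fin N → ℂ => q k) q := fun k => 
    (contDiff_apply ℝ ℂ k).contDiffAt
  refine ContDiffAt.add (contDiffAt_const.mul (ContDiffAt.sum fun k _ => contDiffAt_const.mul ?_)) 
    (contDiffAt_const.mul (ContDiffAt.sum fun k _ => ContDiffAt.sum fun l hl => contDiffAt_const.mul ?_))
  · exact (hk k).norm_sq ℝ
  · have hne : q k - q l ≠ 0 := sub_ne_zero.2 (hq k l (Finset.mem_Ioi.1 hl).ne)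
    exact (((hk k).sub (hk l)).norm ℝ hne).rpow_const_of_ne (norm_ne_zero_iff.2 hne)

noncomputable def Gl {N : ℕ} (A : ℝ) (m : Fin N → ℝ) (q v : Fin N → ℂ) (t : ℝ) : ℝ :=
  (∑ k, m k) * ∑ k, m k * 
      (((q k).re + t * (v k).re) * (v k).re + ((q k).im + t * (v k).im) * (v k).im) -
      ∑ k, ∑ l ∈ Finset.Ioi k, m k * m l * 
      ((((q k - q l).re + t * (v k - v l).re) * (v k - v l).re + ((q k - q l).im + t * (v k - v l).im) * (v k - v l).im) *
       (((q k - q l).re + t * (v k - v l).re)^2 + ((q k - q l).im + t * (v k - v l).im)^2) ^ (-A/2))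

lemma fderiv_line {N : ℕ} {A : ℝ} (hA : 2 < A)
    {m : Fin N → ℝ} 
    {f : (Fin N → ℂ) → ℝ}
    (hf : ∀ q : Fin N → ℂ, (∀ k l, k ≠ l → q k ≠ q l) →
      f q = ((∑ k, m k) / 2) * ∑ k, m k * ‖q k‖ ^ 2 +
        (1 / (A - 2)) * ∑ k, ∑ l ∈ Finset.Ioi k, m k * m l * ‖q k - q l‖ ^ (2 - A))
    (q v : Fin N → ℂ) (t : ℝ) (hq : ∀ k l, k ≠ l → (q + t • v) k ≠ (q + t • v) l) : 
    fderiv ℝ f (q + t • v) v = Gl A m q v t := by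
  obtain ⟨h1, h2⟩ := contDiffAt_f hf _ hq
  have hl : HasDerivAt (fun s : ℝ => q + s • v) v t := by
    simpa using ((hasDerivAt_id t).smul_const v).const_add q
  have h3 := (h2.differentiableAt (by norm_num)).hasFDerivAt.comp_hasDerivAt t hl
  refine h3.unique ?_
  have h4 : f ∘ (fun s : ℝ => q + s • v) =ᶠ[nhds t] fun s => ((∑ k, m k) / 2) * ∑ k, m k * ‖q k + s * v k‖ ^ 2 +
        (1 / (A - 2)) * ∑ k, ∑ l ∈ Finset.Ioi k, m k * m l * ‖(q k - q l) + s * (v k - v l)‖ ^ (2 - A) := by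
    filter_upwards [hl.continuousAt.eventually h1] with s hs
    rw [Function.comp, hf _ hs]
    simp only [Pi.add_apply, Pi.smul_apply, Complex.real_smul]
    refine congrArg₂ _ rfl (congrArg _ (Finset.sum_congr rfl fun k _ => Finset.sum_congr rfl fun l _ => ?_))
    rw [show q k + s * v k - (q l + s * v l) = q k - q l + s * (v k - v l) by ring]
  refine HasDerivAt.congr_of_eventuallyEq ?_ h4
  have h5 : HasDerivAt (fun s : ℝ => ((∑ k, m k) / 2) * ∑ k, m k * ‖q k + s * v k‖ ^ 2) 
     (((∑ k, m k) / 2) * ∑ k, m k * (2 * (((q k).re + t * (v k).re) * (v k).re + ((q k).im + t * (v k).im) * (v k).im))) t := 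
    HasDerivAt.const_mul _ (HasDerivAt.fun_sum fun k _ => (aux_d0 _ _ t).const_mul _)
  have h6 := HasDerivAt.const_mul (1 / (A - 2)) (HasDerivAt.fun_sum fun k (_ : k ∈ univ) => 
    HasDerivAt.fun_sum fun l (hl : l ∈ Finset.Ioi k) => (aux_d1 A (q k - q l) (v k - v l) t (by
      have := sub_ne_zero.2 (hq k l (Finset.mem_Ioi.1 hl).ne)
      simp only [Pi.add_apply, Pi.smul_apply, Complex.real_smul] at this
      convert this using 1; ring)).const_mul (m k * m l))
  refine (h5.fun_add h6).congr_deriv ?_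
  have hA' : A - 2 ≠ 0 := by linarith
  rw [Gl, sub_eq_add_neg]
  refine congrArg₂ _ ?_ ?_
  · simp only [Finset.mul_sum]
    refine Finset.sum_congr rfl fun k _ => ?_
    ring
  · simp only [Finset.mul_sum, ← Finset.sum_neg_distrib]
    refine Finset.sum_congr rfl fun k _ => Finset.sum_congr rfl fun l _ => ?_
    have : ∀ a Y : ℝ, 1 / (A - 2) * (a * ((2 - A) * Y)) = -(a * Y) := by
      intro a Y
      field_simp
      ring
    rw [← sub_eq_add_neg]
    exact this _ _

lemma ofReal_ne {N : ℕ} {x : Fin N → ℝ} (hx : StrictMono x) : 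
    ∀ k l, k ≠ l → (fun k => (x k : ℂ)) k ≠ (fun k => (x k : ℂ)) l := by
  intro k l h
  simpa using hx.injective.ne h

lemma fderiv_real {N : ℕ} {A : ℝ} (hA : 2 < A)
    {m : Fin N → ℝ} 
    {f : (Fin N → ℂ) → ℝ}
    (hf : ∀ q : Fin N → ℂ, (∀ k l, k ≠ l → q k ≠ q l) →
      f q = ((∑ k, m k) / 2) * ∑ k, m k * ‖q k‖ ^ 2 +
        (1 / (A - 2)) * ∑ k, ∑ l ∈ Finset.Ioi k, m k * m l * ‖q k - q l‖ ^ (2 - A))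
    (x : Fin N → ℝ) (hx : StrictMono x) (v : Fin N → ℂ) :
    fderiv ℝ f (fun k => (x k : ℂ)) v = (∑ k, m k) * ∑ k, m k * (x k * (v k).re) -
      ∑ k, ∑ l ∈ Finset.Ioi k, m k * m l * ((x k - x l) * ((v k).re - (v l).re) * |x k - x l| ^ (-A)) := by
  have := fderiv_line hA hf (fun k => (x k : ℂ)) v 0 (by simpa using ofReal_ne hx)
  rw [zero_smul, add_zero] at this
  rw [this, Gl]
  simp only [← Complex.ofReal_sub, Complex.ofReal_re, Complex.ofReal_im, zero_mul, add_zero, ne_eq, OfNat.ofNat_ne_zero, not_false_eq_true, zero_pow, aux_sq]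
  simp

lemma Gl_deriv {N : ℕ} (A : ℝ) 
    (m : Fin N → ℝ) (x : Fin N → ℝ) (hx : StrictMono x) (v : Fin N → ℂ) :
    HasDerivAt (Gl A m (fun k => (x k : ℂ)) v) ((∑ k, m k) * ∑ k, m k * ((v k).re ^ 2 + (v k).im ^ 2) -
      ∑ k, ∑ l ∈ Finset.Ioi k, m k * m l * 
        (|x k - x l| ^ (-A) * ((1 - A) * (v k - v l).re ^ 2 + (v k - v l).im ^ 2))) 0 := by
  unfold Gl
  refine HasDerivAt.fun_sub (HasDerivAt.const_mul _ (HasDerivAt.fun_sum fun k _ => (aux_lin _ _ 0).const_mul _)) 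
    (HasDerivAt.fun_sum fun k _ => HasDerivAt.fun_sum fun l hl => HasDerivAt.const_mul _ ?_)
  have := aux_d2 A (x k - x l) (v k - v l) (sub_ne_zero.2 (hx.injective.ne (Finset.mem_Ioi.1 hl).ne))
  rw [Complex.ofReal_sub] at this
  exact this

lemma hess_aux {N : ℕ} {f : (Fin N → ℂ) → ℝ} (q v : Fin N → ℂ) (h2 : ContDiffAt ℝ 2 f q) :
    HasDerivAt (fun s : ℝ => fderiv ℝ f (q + s • v) v) (fderiv ℝ (fderiv ℝ f) q v v) 0 := by
  have hl : HasDerivAt (fun s : ℝ => q + s • v) v 0 := by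
    simpa using ((hasDerivAt_id (0:ℝ)).smul_const v).const_add q
  have hd : DifferentiableAt ℝ (fderiv ℝ f) q := 
    (h2.fderiv_right (m := 1) (by norm_num)).differentiableAt (by norm_num)
  have hd' : HasFDerivAt (fderiv ℝ f) (fderiv ℝ (fderiv ℝ f) q) (q + (0:ℝ) • v) := by
    rw [zero_smul, add_zero]
    exact hd.hasFDerivAt
  have h3 := hd'.comp_hasDerivAt (0:ℝ) hl
  have h4 := h3.clm_apply (hasDerivAt_const (0:ℝ) v)
  refine h4.congr_deriv ?_
  simp

lemma hess_real {N : ℕ} {A : ℝ} (hA : 2 < A)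
    {m : Fin N → ℝ} 
    {f : (Fin N → ℂ) → ℝ}
    (hf : ∀ q : Fin N → ℂ, (∀ k l, k ≠ l → q k ≠ q l) →
      f q = ((∑ k, m k) / 2) * ∑ k, m k * ‖q k‖ ^ 2 +
        (1 / (A - 2)) * ∑ k, ∑ l ∈ Finset.Ioi k, m k * m l * ‖q k - q l‖ ^ (2 - A))
    (x : Fin N → ℝ) (hx : StrictMono x) (v : Fin N → ℂ) :
    fderiv ℝ (fderiv ℝ f) (fun k => (x k : ℂ)) v v = (∑ k, m k) * ∑ k, m k * ((v k).re ^ 2 + (v k).im ^ 2) -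
      ∑ k, ∑ l ∈ Finset.Ioi k, m k * m l * 
        (|x k - x l| ^ (-A) * ((1 - A) * (v k - v l).re ^ 2 + (v k - v l).im ^ 2)) := by
  obtain ⟨h1, h2⟩ := contDiffAt_f hf _ (ofReal_ne hx)
  refine (hess_aux _ v h2).unique ?_
  refine HasDerivAt.congr_of_eventuallyEq (Gl_deriv A m x hx v) ?_
  have hc : Filter.Tendsto (fun s : ℝ => (fun k => (x k : ℂ)) + s • v) (nhds 0) (nhds (fun k => (x k : ℂ))) := by
    have : Continuous (fun s : ℝ => (fun k => (x k : ℂ)) + s • v) := by fun_prop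
    have h := this.tendsto 0
    rwa [zero_smul, add_zero] at h
  exact (hc.eventually h1).mono (fun s hs => fderiv_line hA hf _ v s hs)

lemma sum_Ioi_half {N : ℕ} (g : Fin N → Fin N → ℝ) (hs : ∀ k l, g k l = g l k) (h0 : ∀ k, g k k = 0) :
    ∑ k, ∑ l ∈ Finset.Ioi k, g k l = 1 / 2 * ∑ k, ∑ l, g k l := by
  have h1 : ∑ k, ∑ l ∈ Finset.Ioi k, g k l = ∑ k, ∑ l, if k < l then g k l else 0 := by
    refine Finset.sum_congr rfl fun k _ => ?_
    rw [← Finset.sum_filter]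
    congr 1
    ext l; simp
  have h2 : ∑ k, ∑ l, (if k < l then g k l else 0) = ∑ k, ∑ l, if l < k then g k l else 0 := by
    rw [Finset.sum_comm]
    refine Finset.sum_congr rfl fun k _ => Finset.sum_congr rfl fun l _ => ?_
    rw [hs]
  have h3 : ∑ k, ∑ l, g k l = ∑ k, ∑ l, (if k < l then g k l else 0) + ∑ k, ∑ l, (if l < k then g k l else 0) := by
    rw [← Finset.sum_add_distrib]
    refine Finset.sum_congr rfl fun k _ => ?_
    rw [← Finset.sum_add_distrib]
    refine Finset.sum_congr rfl fun l _ => ?_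
    rcases lt_trichotomy k l with h | h | h
    · simp [h, h.not_gt]
    · subst h; simp [h0]
    · simp [h, h.not_gt]
  rw [h1, h3, ← h2]; ring

lemma form_eq {N : ℕ} (m : Fin N → ℝ) (ρ : Fin N → Fin N → ℝ) (hρ : ∀ k l, ρ k l = ρ l k) (v w : Fin N → ℝ) :
    ∑ k, ∑ l ∈ Finset.Ioi k, m k * m l * (ρ k l * ((v k - v l) * (w k - w l))) = 
      ∑ k, m k * w k * ∑ l, m l * (ρ k l * (v k - v l)) := by
  rw [sum_Ioi_half]
  · have h : ∑ k, ∑ l, m k * m l * (ρ k l * ((v k - v l) * (w k - w l))) = 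
      ∑ k, ∑ l, m k * w k * (m l * (ρ k l * (v k - v l))) + ∑ k, ∑ l, m l * w l * (m k * (ρ l k * (v l - v k))) := by
      rw [← Finset.sum_add_distrib]
      refine Finset.sum_congr rfl fun k _ => ?_
      rw [← Finset.sum_add_distrib]
      refine Finset.sum_congr rfl fun l _ => ?_
      rw [hρ l k]; ring
    rw [h, Finset.sum_comm (f := fun k l => m l * w l * (m k * (ρ l k * (v l - v k))))]
    simp only [Finset.mul_sum]
    ring_nf
  · intro k l; rw [hρ]; ring
  · intro k; simp

lemma key {N : ℕ} (A : ℝ) (hA : 2 < A) (m : Fin N → ℝ) (hm : ∀ k, 0 < m k) (M lam : ℝ)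
    (x v : Fin N → ℝ) (hx : StrictMono x)
    (hLx : ∀ k, ∑ l, m l * (|x k - x l| ^ (-A) * (x k - x l)) = M * x k)
    (hLv : ∀ k, ∑ l, m l * (|x k - x l| ^ (-A) * (v k - v l)) = lam * v k)
    (hv : ∃ i j, i < j ∧ v i < v j) : M < lam ∨ ∃ s c, 0 < s ∧ ∀ k, x k = s * v k + c := by
  obtain ⟨i₀, j₀, h₀, h₀'⟩ := hv
  have hne : (univ.filter (fun p : Fin N × Fin N => p.1 < p.2 ∧ v p.1 < v p.2)).Nonempty := 
    ⟨(i₀, j₀), by simp [h₀, h₀']⟩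
  obtain ⟨⟨i, j⟩, hp, hmin⟩ := Finset.exists_min_image _ (fun p => (x p.2 - x p.1) / (v p.2 - v p.1)) hne
  simp only [mem_filter, mem_univ, true_and, Prod.forall] at hp hmin
  obtain ⟨hij, hvij⟩ := hp
  set s := (x j - x i) / (v j - v i) with hs
  have hxij := hx hij
  have hs0 : 0 < s := div_pos (by linarith) (by linarith)
  have hsv : s * (v j - v i) = x j - x i := by rw [hs]; field_simp [(sub_pos.2 hvij).ne']
  have hz : ∀ a b, a ≤ b → x a - s * v a ≤ x b - s * v b := by
    intro a b hab
    rcases hab.eq_or_lt with h | h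
    · rw [h]
    · by_cases hvab : v a < v b
      · have := hmin a b ⟨h, hvab⟩
        rw [le_div_iff₀ (by linarith)] at this
        linarith
      · have h2 := hx h
        nlinarith
  by_cases hc : ∀ k, x k - s * v k = x i - s * v i
  · right
    exact ⟨s, x i - s * v i, hs0, fun k => by linarith [hc k]⟩
  left
  push Not at hc
  obtain ⟨l₀, hl₀⟩ := hc
  have hD : ∑ l, m l * ((|x j - x l| ^ (-A) - |x i - x l| ^ (-A)) * ((x i - s * v i) - (x l - s * v l))) 
      = (M - lam) * (x j - x i) := by
    have : (M - lam) * (x j - x i) = (M * x j - s * (lam * v j)) - (M * x i - s * (lam * v i)) := by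
      linear_combination lam * hsv
    rw [this, ← hLx, ← hLx, ← hLv, ← hLv]
    simp only [Finset.mul_sum, ← Finset.sum_sub_distrib]
    refine Finset.sum_congr rfl fun l _ => ?_
    linear_combination m l * |x j - x l| ^ (-A) * hsv
  have hzij : x i - s * v i = x j - s * v j := by linarith
  have hterm : ∀ l, (m l * ((|x j - x l| ^ (-A) - |x i - x l| ^ (-A)) * ((x i - s * v i) - (x l - s * v l))) ≤ 0) ∧ 
     (x l - s * v l ≠ x i - s * v i → m l * ((|x j - x l| ^ (-A) - |x i - x l| ^ (-A)) * ((x i - s * v i) - (x l - s * v l))) < 0) := by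
    intro l
    by_cases h : x l - s * v l = x i - s * v i
    · simp [h]
    suffices m l * ((|x j - x l| ^ (-A) - |x i - x l| ^ (-A)) * ((x i - s * v i) - (x l - s * v l))) < 0 from ⟨this.le, fun _ => this⟩
    refine mul_neg_of_pos_of_neg (hm l) ?_
    rcases lt_or_ge l i with hl | hl
    · have h1 := lt_of_le_of_ne (hz l i hl.le) h
      have h2 := hx hl
      refine mul_neg_of_neg_of_pos ?_ (by linarith)
      rw [abs_of_pos (by linarith), abs_of_pos (by linarith)]
      exact sub_neg.2 (Real.rpow_lt_rpow_of_neg (by linarith) (by linarith) (by linarith))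
    rcases lt_or_ge j l with hl' | hl'
    · have h1 := lt_of_le_of_ne (hz i l hl) (Ne.symm h)
      have h2 := hx hl'
      refine mul_neg_of_pos_of_neg ?_ (by linarith)
      rw [abs_of_neg (by linarith), abs_of_neg (by linarith)]
      exact sub_pos.2 (Real.rpow_lt_rpow_of_neg (by linarith) (by linarith) (by linarith))
    · exact absurd (le_antisymm ((hz l j hl').trans hzij.symm.le) (hz i l hl)) h
  have hlt : ∑ l, m l * ((|x j - x l| ^ (-A) - |x i - x l| ^ (-A)) * ((x i - s * v i) - (x l - s * v l))) < 0 := by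
    have := Finset.sum_lt_sum (s := univ) (fun l _ => (hterm l).1) ⟨l₀, mem_univ _, (hterm l₀).2 hl₀⟩
    simpa using this
  rw [hD] at hlt
  nlinarith

lemma key2 {N : ℕ} (hN : 2 ≤ N) (A : ℝ) (hA : 2 < A) (m : Fin N → ℝ) (hm : ∀ k, 0 < m k) (M lam : ℝ)
    (x v : Fin N → ℝ) (hx : StrictMono x)
    (hLx : ∀ k, ∑ l, m l * (|x k - x l| ^ (-A) * (x k - x l)) = M * x k)
    (hLv : ∀ k, ∑ l, m l * (|x k - x l| ^ (-A) * (v k - v l)) = lam * v k)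
    (hv : v ≠ 0) (h1 : ∑ k, m k * v k = 0) (h2 : ∑ k, m k * x k * v k = 0) : M < lam := by
  have hsq : 0 < ∑ k, m k * v k ^ 2 := by
    obtain ⟨k, hk⟩ := Function.ne_iff.1 hv
    have : v k ≠ 0 := hk
    refine Finset.sum_pos' (fun k _ => mul_nonneg (hm k).le (sq_nonneg _)) ⟨k, mem_univ _, ?_⟩
    have := hm k
    positivity
  have hno : ∀ s c, s ≠ 0 → ¬ ∀ k, x k = s * v k + c := by
    intro s c hs h
    have : ∑ k, m k * x k * v k = s * ∑ k, m k * v k ^ 2 + c * ∑ k, m k * v k := by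
      rw [Finset.mul_sum, Finset.mul_sum, ← Finset.sum_add_distrib]
      refine Finset.sum_congr rfl fun k _ => ?_
      rw [h k]; ring
    rw [h1, h2] at this
    have : s * ∑ k, m k * v k ^ 2 = 0 := by linarith
    rcases mul_eq_zero.1 this with h | h
    · exact hs h
    · linarith
  by_cases hc : ∃ i j, i < j ∧ v i < v j
  · rcases key A hA m hm M lam x v hx hLx hLv hc with h | ⟨s, c, hs, h⟩
    · exact h
    · exact absurd h (hno s c hs.ne')
  by_cases hc' : ∃ i j, i < j ∧ v j < v i
  · rcases key A hA m hm M lam x (-v) hx hLx (fun k => by 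
      have := hLv k
      simp only [Pi.neg_apply]
      rw [mul_neg, ← this, ← Finset.sum_neg_distrib]
      exact Finset.sum_congr rfl fun l _ => by ring) (by simpa using hc') with h | ⟨s, c, hs, h⟩
    · exact h
    · exact absurd (fun k => by rw [h k]; simp) (hno (-s) c (by linarith))
  exfalso
  push Not at hc hc'
  have hconst : ∀ k, v k = v ⟨0, by omega⟩ := by
    intro k
    rcases (Fin.mk_le_of_le_val (Nat.zero_le k.1) : (⟨0, by omega⟩ : Fin N) ≤ k).eq_or_lt with h | h
    · rw [← h]
    · exact le_antisymm (hc _ _ h) (hc' _ _ h)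
  have : ∑ k, m k * v k ^ 2 = v ⟨0, by omega⟩ * ∑ k, m k * v k := by
    rw [Finset.mul_sum]
    refine Finset.sum_congr rfl fun k _ => ?_
    rw [hconst k]; ring
  rw [h1] at this
  linarith

lemma spectral {E : Type*} [NormedAddCommGroup E] [InnerProductSpace ℝ E] [FiniteDimensional ℝ E]
    (T : E →ₗ[ℝ] E) (hT : T.IsSymmetric) (S : Submodule ℝ E) (hS : ∀ v ∈ S, T v ∈ S) (M : ℝ)
    (h : ∀ lam : ℝ, ∀ v ∈ S, v ≠ 0 → T v = lam • v → M < lam) :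
    ∀ v ∈ S, v ≠ 0 → M * inner ℝ v v < inner ℝ (T v) v := by
  intro v hv hv0
  have hT' := hT.restrict_invariant hS
  set b := hT'.eigenvectorBasis rfl with hb
  set ev := hT'.eigenvalues rfl with hev
  have hlt : ∀ i, M < ev i := by
    intro i
    have h1 := hT'.apply_eigenvectorBasis rfl i
    refine h _ (b i) (b i).2 ?_ ?_
    · have := b.orthonormal.ne_zero i
      simpa using this
    · exact congrArg Subtype.val h1
  set w : S := ⟨v, hv⟩ with hw
  have hw0 : w ≠ 0 := by simpa [hw] using hv0
  have e1 : inner ℝ v v = ∑ i, (b.repr w i) * (b.repr w i) := by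
    have := b.sum_inner_mul_inner w w
    simp only [b.repr_apply_apply]
    change inner ℝ w w = _
    rw [← this]
    exact Finset.sum_congr rfl fun i _ => by rw [real_inner_comm]
  have e2 : inner ℝ (T v) v = ∑ i, ev i * ((b.repr w i) * (b.repr w i)) := by
    have := b.sum_inner_mul_inner (T.restrict hS w) w
    change inner ℝ (T.restrict hS w) w = _
    rw [← this]
    refine Finset.sum_congr rfl fun i _ => ?_
    have h3 := hT'.eigenvectorBasis_apply_self_apply rfl w i
    rw [real_inner_comm, ← b.repr_apply_apply, ← b.repr_apply_apply, h3]
    simp [hev, hb, mul_assoc]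
  rw [e1, e2, Finset.mul_sum]
  refine Finset.sum_lt_sum (fun i _ => mul_le_mul_of_nonneg_right (hlt i).le (mul_self_nonneg _)) ?_
  have : b.repr w ≠ 0 := by simpa using hw0
  obtain ⟨i, hi⟩ : ∃ i, b.repr w i ≠ 0 := by
    by_contra hcon
    push Not at hcon
    exact this (by ext i; simpa using hcon i)
  exact ⟨i, mem_univ _, mul_lt_mul_of_pos_right (hlt i) (mul_self_pos.2 hi)⟩

lemma L_symm {N : ℕ} (m : Fin N → ℝ) (ρ : Fin N → Fin N → ℝ) (hρ : ∀ k l, ρ k l = ρ l k) (v w : Fin N → ℝ) :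
    ∑ k, m k * w k * ∑ l, m l * (ρ k l * (v k - v l)) = 
      ∑ k, m k * v k * ∑ l, m l * (ρ k l * (w k - w l)) := by
  rw [← form_eq m ρ hρ, ← form_eq m ρ hρ]
  refine Finset.sum_congr rfl fun k _ => Finset.sum_congr rfl fun l _ => ?_
  ring

noncomputable def TT {N : ℕ} (m : Fin N → ℝ) (ρ : Fin N → Fin N → ℝ) : 
    EuclideanSpace ℝ (Fin N) →ₗ[ℝ] EuclideanSpace ℝ (Fin N) where
  toFun u := WithLp.toLp 2 fun k => √(m k) * ∑ l, m l * (ρ k l * (u k / √(m k) - u l / √(m l)))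
  map_add' u v := by
    ext k
    simp only [PiLp.add_apply, ← mul_add, ← Finset.sum_add_distrib]
    congr 1
    refine Finset.sum_congr rfl fun l _ => ?_
    ring
  map_smul' c u := by
    ext k
    simp only [PiLp.smul_apply, smul_eq_mul, RingHom.id_apply, Finset.mul_sum]
    refine Finset.sum_congr rfl fun l _ => ?_
    ring

lemma neg_form {N : ℕ} (hN : 2 ≤ N) (A : ℝ) (hA : 2 < A) (m : Fin N → ℝ) (hm : ∀ k, 0 < m k) (M : ℝ)
    (x v : Fin N → ℝ) (hx : StrictMono x)
    (hLx : ∀ k, ∑ l, m l * (|x k - x l| ^ (-A) * (x k - x l)) = M * x k)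
    (hv : v ≠ 0) (h1 : ∑ k, m k * v k = 0) (h2 : ∑ k, m k * x k * v k = 0) : 
    M * ∑ k, m k * v k ^ 2 < ∑ k, m k * v k * ∑ l, m l * (|x k - x l| ^ (-A) * (v k - v l)) := by
  set ρ : Fin N → Fin N → ℝ := fun k l => |x k - x l| ^ (-A) with hρdef
  have hρ : ∀ k l, ρ k l = ρ l k := fun k l => by simp only [hρdef]; rw [abs_sub_comm]
  have hs : ∀ k, 0 < √(m k) := fun k => Real.sqrt_pos.2 (hm k)
  have hss : ∀ k, √(m k) * √(m k) = m k := fun k => Real.mul_self_sqrt (hm k).le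
  set T := TT m ρ with hTdef
  have hTapp : ∀ u k, T u k = √(m k) * ∑ l, m l * (ρ k l * (u k / √(m k) - u l / √(m l))) := fun u k => rfl
  have hinner : ∀ u w : EuclideanSpace ℝ (Fin N), inner ℝ u w = ∑ k, u k * w k := by
    intro u w
    simp [PiLp.inner_apply, mul_comm]
  have hTw : ∀ (u : EuclideanSpace ℝ (Fin N)) (w : Fin N → ℝ), ∑ k, √(m k) * w k * T u k = 
      ∑ k, m k * w k * ∑ l, m l * (ρ k l * (u k / √(m k) - u l / √(m l))) := by
    intro u w
    refine Finset.sum_congr rfl fun k _ => ?_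
    rw [hTapp]
    generalize ∑ l, m l * (ρ k l * (u k / √(m k) - u l / √(m l))) = Z
    linear_combination w k * Z * hss k
  have hTin : ∀ u w : EuclideanSpace ℝ (Fin N), inner ℝ (T u) w = 
      ∑ k, m k * (w k / √(m k)) * ∑ l, m l * (ρ k l * (u k / √(m k) - u l / √(m l))) := by
    intro u w
    rw [hinner, ← hTw u (fun k => w k / √(m k))]
    refine Finset.sum_congr rfl fun k _ => ?_
    have := (hs k).ne'
    field_simp
  have hTs : T.IsSymmetric := by
    intro u w
    rw [hTin, real_inner_comm, hTin]
    exact L_symm m ρ hρ (fun k => u k / √(m k)) (fun k => w k / √(m k))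
  let S : Submodule ℝ (EuclideanSpace ℝ (Fin N)) := 
    { carrier := {u | ∑ k, √(m k) * 1 * u k = 0 ∧ ∑ k, √(m k) * x k * u k = 0}
      zero_mem' := by simp
      add_mem' := by
        rintro a b ⟨ha, ha'⟩ ⟨hb, hb'⟩
        simp only [Set.mem_ofPred_eq, PiLp.add_apply, mul_add, Finset.sum_add_distrib] at *
        constructor <;> linarith
      smul_mem' := by
        rintro c a ⟨ha, ha'⟩
        constructor
        · have : ∑ k, √(m k) * 1 * (c • a) k = c * ∑ k, √(m k) * 1 * a k := by
            rw [Finset.mul_sum]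
            exact Finset.sum_congr rfl fun k _ => by simp; ring
          rw [this, ha, mul_zero]
        · have : ∑ k, √(m k) * x k * (c • a) k = c * ∑ k, √(m k) * x k * a k := by
            rw [Finset.mul_sum]
            exact Finset.sum_congr rfl fun k _ => by simp; ring
          rw [this, ha', mul_zero] }
  have hmS : ∀ u, u ∈ S ↔ (∑ k, √(m k) * 1 * u k = 0 ∧ ∑ k, √(m k) * x k * u k = 0) := fun u => Iff.rfl
  have conv : ∀ (u : EuclideanSpace ℝ (Fin N)) (w : Fin N → ℝ), ∑ k, √(m k) * w k * u k = ∑ k, m k * w k * (u k / √(m k)) := by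
    intro u w
    refine Finset.sum_congr rfl fun k _ => ?_
    have := (hs k).ne'
    nth_rewrite 2 [← hss k]
    field_simp
  have hSinv : ∀ u ∈ S, T u ∈ S := by
    intro u hu
    rw [hmS] at hu ⊢
    constructor
    · rw [hTw u (fun _ => 1), L_symm m ρ hρ (fun k => u k / √(m k)) (fun _ => 1)]
      simp
    · rw [hTw u x, L_symm m ρ hρ (fun k => u k / √(m k)) x]
      simp only [hρdef, hLx]
      have := hu.2
      rw [conv] at this
      calc _ = M * ∑ k, m k * x k * (u k / √(m k)) := by
            rw [Finset.mul_sum]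
            exact Finset.sum_congr rfl fun k _ => by ring
        _ = 0 := by rw [this, mul_zero]
  have hsp := spectral T hTs S hSinv M (by
    intro lam u hu hu0 hTu
    rw [hmS, conv u (fun _ => 1), conv] at hu
    refine key2 hN A hA m hm M lam x (fun k => u k / √(m k)) hx hLx ?_ ?_ (by simpa using hu.1) hu.2
    · intro k
      have h3 : T u k = lam * u k := by rw [hTu]; simp
      rw [hTapp] at h3
      have := (hs k).ne'
      simp only [hρdef] at h3
      field_simp
      field_simp at h3
      exact h3
    · intro h0
      apply hu0
      ext k
      have := congrFun h0 k
      simpa [(hs k).ne'] using this)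
  set u : EuclideanSpace ℝ (Fin N) := WithLp.toLp 2 fun k => √(m k) * v k with hu
  have huk : ∀ k, u k / √(m k) = v k := by
    intro k
    have := (hs k).ne'
    simp only [hu]
    field_simp
  have := hsp u (by 
    rw [hmS, conv u (fun _ => 1), conv]
    simp only [huk, mul_one]
    exact ⟨h1, h2⟩) (by
    intro h0
    apply hv
    ext k
    rw [← huk k, h0]; simp)
  rw [hTin, hinner] at this
  simp only [huk] at this
  convert this using 2
  refine Finset.sum_congr rfl fun k _ => ?_
  simp only [hu]
  linear_combination (-(v k ^ 2)) * hss k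

lemma fderiv_real' {N : ℕ} {A : ℝ} (hA : 2 < A)
    {m : Fin N → ℝ} 
    {f : (Fin N → ℂ) → ℝ}
    (hf : ∀ q : Fin N → ℂ, (∀ k l, k ≠ l → q k ≠ q l) →
      f q = ((∑ k, m k) / 2) * ∑ k, m k * ‖q k‖ ^ 2 +
        (1 / (A - 2)) * ∑ k, ∑ l ∈ Finset.Ioi k, m k * m l * ‖q k - q l‖ ^ (2 - A))
    (x : Fin N → ℝ) (hx : StrictMono x) (v : Fin N → ℂ) :
    fderiv ℝ f (fun k => (x k : ℂ)) v = ∑ k, m k * (v k).re * 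
      ((∑ k, m k) * x k - ∑ l, m l * (|x k - x l| ^ (-A) * (x k - x l))) := by
  rw [fderiv_real hA hf x hx v]
  have := form_eq m (fun k l => |x k - x l| ^ (-A)) (fun k l => by rw [abs_sub_comm]) x (fun k => (v k).re)
  have h2 : ∑ k, ∑ l ∈ Finset.Ioi k, m k * m l * ((x k - x l) * ((v k).re - (v l).re) * |x k - x l| ^ (-A)) = 
    ∑ k, ∑ l ∈ Finset.Ioi k, m k * m l * (|x k - x l| ^ (-A) * ((x k - x l) * ((v k).re - (v l).re))) :=
    Finset.sum_congr rfl fun k _ => Finset.sum_congr rfl fun l _ => by ring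
  rw [h2, this, Finset.mul_sum, ← Finset.sum_sub_distrib]
  exact Finset.sum_congr rfl fun k _ => by ring

lemma crit_iff {N : ℕ} {A : ℝ} (hA : 2 < A)
    {m : Fin N → ℝ} (hm : ∀ k, 0 < m k)
    {f : (Fin N → ℂ) → ℝ}
    (hf : ∀ q : Fin N → ℂ, (∀ k l, k ≠ l → q k ≠ q l) →
      f q = ((∑ k, m k) / 2) * ∑ k, m k * ‖q k‖ ^ 2 +
        (1 / (A - 2)) * ∑ k, ∑ l ∈ Finset.Ioi k, m k * m l * ‖q k - q l‖ ^ (2 - A))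
    (x : Fin N → ℝ) (hx : StrictMono x) (h : fderiv ℝ f (fun k => (x k : ℂ)) = 0) :
    ∀ k, ∑ l, m l * (|x k - x l| ^ (-A) * (x k - x l)) = (∑ k, m k) * x k := by
  intro k
  have := fderiv_real' hA hf x hx (Pi.single k 1)
  rw [h, Finset.sum_eq_single k] at this
  · simp only [zero_apply, Pi.single_eq_same, Complex.one_re, mul_one] at this
    rcases mul_eq_zero.1 this.symm with h | h
    · exact absurd h (hm k).ne'
    · linarith
  · intro l _ hl
    simp [hl]
  · simp

lemma pow_mono {A a b : ℝ} (hA : 2 < A) (ha : a < 0) (hb : b < 0) : 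
    (|a| ^ (-A) * a - |b| ^ (-A) * b) * (a - b) ≤ 0 := by
  have key : ∀ a b : ℝ, a < 0 → b < 0 → a ≤ b → |b| ^ (-A) * b ≤ |a| ^ (-A) * a := by
    intro a b ha hb hab
    rw [abs_of_neg ha, abs_of_neg hb]
    have h : ∀ c : ℝ, c < 0 → (-c) ^ (-A) * c = - (-c) ^ (1 - A) := by
      intro c hc
      rw [show 1 - A = -A + 1 by ring, Real.rpow_add (by linarith), Real.rpow_one]; ring
    rw [h a ha, h b hb]
    exact neg_le_neg (Real.rpow_le_rpow_of_nonpos (by linarith) (by linarith) (by linarith))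
  rcases le_total a b with h | h
  · have := key a b ha hb h
    nlinarith
  · have := key b a hb ha h
    nlinarith

lemma uniq {N : ℕ} {A : ℝ} (hA : 2 < A)
    {m : Fin N → ℝ} (hm : ∀ k, 0 < m k)
    (x y : Fin N → ℝ) (hx : StrictMono x) (hy : StrictMono y) 
    (hLx : ∀ k, ∑ l, m l * (|x k - x l| ^ (-A) * (x k - x l)) = (∑ k, m k) * x k)
    (hLy : ∀ k, ∑ l, m l * (|y k - y l| ^ (-A) * (y k - y l)) = (∑ k, m k) * y k) : x = y := by
  by_contra hne
  have h1 := form_eq m (fun k l => |x k - x l| ^ (-A)) (fun k l => by rw [abs_sub_comm]) x (x - y)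
  have h2 := form_eq m (fun k l => |y k - y l| ^ (-A)) (fun k l => by rw [abs_sub_comm]) y (x - y)
  simp only [hLx] at h1
  simp only [hLy] at h2
  have h3 : ∑ k, m k * (x - y) k * ((∑ k, m k) * x k) - ∑ k, m k * (x - y) k * ((∑ k, m k) * y k) = 
    (∑ k, m k) * ∑ k, m k * (x k - y k) ^ 2 := by
    rw [← Finset.sum_sub_distrib, Finset.mul_sum]
    exact Finset.sum_congr rfl fun k _ => by simp only [Pi.sub_apply]; ring
  rw [← h1, ← h2, ← Finset.sum_sub_distrib] at h3
  simp only [← Finset.sum_sub_distrib] at h3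
  obtain ⟨k₀, hk₀⟩ := Function.ne_iff.1 hne
  have hM : 0 < ∑ k, m k := Finset.sum_pos (fun k _ => hm k) ⟨k₀, mem_univ _⟩
  have hp : 0 < ∑ k, m k * (x k - y k) ^ 2 := by
    refine Finset.sum_pos' (fun k _ => mul_nonneg (hm k).le (sq_nonneg _)) ⟨k₀, mem_univ _, ?_⟩
    have := hm k₀
    have := sub_ne_zero.2 hk₀
    positivity
  have hn := mul_pos hM hp
  rw [← h3] at hn
  refine absurd hn (not_lt.2 (Finset.sum_nonpos fun k _ => Finset.sum_nonpos fun l hl => ?_))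
  have hkl := Finset.mem_Ioi.1 hl
  have := pow_mono hA (sub_neg.2 (hx hkl)) (sub_neg.2 (hy hkl))
  have hmm := mul_pos (hm k) (hm l)
  simp only [Pi.sub_apply]
  nlinarith

lemma bound_K {N : ℕ} {A : ℝ} (hA : 2 < A)
    {m : Fin N → ℝ} (hm : ∀ k, 0 < m k) (C : ℝ) (hC : 0 ≤ C) :
    ∃ R δ : ℝ, 0 < δ ∧ ∀ x : Fin N → ℝ, StrictMono x → 
      ((∑ k, m k) / 2) * ∑ k, m k * ‖(x k : ℂ)‖ ^ 2 +
        (1 / (A - 2)) * ∑ k, ∑ l ∈ Finset.Ioi k, m k * m l * ‖(x k : ℂ) - x l‖ ^ (2 - A) ≤ C →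
      (∀ k, |x k| ≤ R) ∧ ∀ k l, k < l → δ ≤ x l - x k := by
  have hA' : 0 < A - 2 := by linarith
  set M := ∑ k, m k with hM
  have hM0 : 0 ≤ M := Finset.sum_nonneg fun k _ => (hm k).le
  set R := 1 + ∑ k, 2 * C / (M * m k) with hR
  have hnn : ∀ k, 0 ≤ 2 * C / (M * m k) := fun k => by have := hm k; positivity
  have hR1 : 1 ≤ R := by
    have := Finset.sum_nonneg fun k (_ : k ∈ univ) => hnn k
    linarith
  set D := 1 + ∑ k, ∑ l, C * (A - 2) / (m k * m l) with hD
  have hnn2 : ∀ k l, 0 ≤ C * (A - 2) / (m k * m l) := fun k l => by 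
    have := hm k; have := hm l; positivity
  have hD1 : 1 ≤ D := by
    have := Finset.sum_nonneg fun k (_ : k ∈ univ) => Finset.sum_nonneg fun l (_ : l ∈ univ) => hnn2 k l
    linarith
  have hD0 : 0 < D := by linarith
  refine ⟨R, D ^ (1 / (2 - A)), Real.rpow_pos_of_pos hD0 _, fun x hx hle => ?_⟩
  have ht1 : ∀ k, 0 ≤ m k * ‖(x k : ℂ)‖ ^ 2 := fun k => by have := hm k; positivity
  have ht2 : ∀ k l, 0 ≤ m k * m l * ‖(x k : ℂ) - x l‖ ^ (2 - A) := fun k l => by 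
    have := hm k; have := hm l; positivity
  have hs1 : 0 ≤ M / 2 * ∑ k, m k * ‖(x k : ℂ)‖ ^ 2 := 
    mul_nonneg (by positivity) (Finset.sum_nonneg fun k _ => ht1 k)
  have hs2 : 0 ≤ (1 / (A - 2)) * ∑ k, ∑ l ∈ Finset.Ioi k, m k * m l * ‖(x k : ℂ) - x l‖ ^ (2 - A) := 
    mul_nonneg (by positivity) (Finset.sum_nonneg fun k _ => Finset.sum_nonneg fun l _ => ht2 k l)
  constructor
  · intro k
    have hMp : 0 < M := Finset.sum_pos (fun k _ => hm k) ⟨k, mem_univ _⟩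
    have h1 : m k * ‖(x k : ℂ)‖ ^ 2 ≤ ∑ k, m k * ‖(x k : ℂ)‖ ^ 2 := 
      Finset.single_le_sum (f := fun k => m k * ‖(x k : ℂ)‖ ^ 2) (fun k _ => ht1 k) (mem_univ k)
    have h2 : M / 2 * (m k * ‖(x k : ℂ)‖ ^ 2) ≤ C := by
      have := mul_le_mul_of_nonneg_left h1 (by positivity : 0 ≤ M / 2)
      linarith
    rw [Complex.norm_real, Real.norm_eq_abs] at h2
    have h3 : |x k| ^ 2 ≤ 2 * C / (M * m k) := by
      rw [le_div_iff₀ (mul_pos hMp (hm k))]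
      linarith
    have h4 : 2 * C / (M * m k) ≤ ∑ k, 2 * C / (M * m k) := 
      Finset.single_le_sum (f := fun k => 2 * C / (M * m k)) (fun k _ => hnn k) (mem_univ k)
    nlinarith [abs_nonneg (x k)]
  · intro k l hkl
    have hd : 0 < x l - x k := sub_pos.2 (hx hkl)
    have h1 : m k * m l * ‖(x k : ℂ) - x l‖ ^ (2 - A) ≤ ∑ k, ∑ l ∈ Finset.Ioi k, m k * m l * ‖(x k : ℂ) - x l‖ ^ (2 - A) := 
      (Finset.single_le_sum (f := fun l => m k * m l * ‖(x k : ℂ) - x l‖ ^ (2 - A)) (fun l _ => ht2 k l) (Finset.mem_Ioi.2 hkl)).trans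
       (Finset.single_le_sum (f := fun k => ∑ l ∈ Finset.Ioi k, m k * m l * ‖(x k : ℂ) - x l‖ ^ (2 - A)) 
         (fun k _ => Finset.sum_nonneg fun l _ => ht2 k l) (mem_univ k))
    have h2 : (1 / (A - 2)) * (m k * m l * ‖(x k : ℂ) - x l‖ ^ (2 - A)) ≤ C := by
      have := mul_le_mul_of_nonneg_left h1 (by positivity : 0 ≤ 1 / (A - 2))
      linarith
    rw [← Complex.ofReal_sub, Complex.norm_real, Real.norm_eq_abs, abs_sub_comm, abs_of_pos hd] at h2
    have hmm := mul_pos (hm k) (hm l)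
    have h3 : (x l - x k) ^ (2 - A) ≤ C * (A - 2) / (m k * m l) := by
      rw [le_div_iff₀ hmm]
      rw [one_div, inv_mul_le_iff₀ hA'] at h2
      linarith
    have h4 : C * (A - 2) / (m k * m l) ≤ ∑ k, ∑ l, C * (A - 2) / (m k * m l) := 
      (Finset.single_le_sum (f := fun l => C * (A - 2) / (m k * m l)) (fun l _ => hnn2 k l) (mem_univ l)).trans
       (Finset.single_le_sum (f := fun k => ∑ l, C * (A - 2) / (m k * m l)) 
         (fun k _ => Finset.sum_nonneg fun l _ => hnn2 k l) (mem_univ k))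
    by_contra hcon
    push Not at hcon
    have h5 := Real.rpow_lt_rpow_of_neg hd hcon (show 2 - A < 0 by linarith)
    rw [← Real.rpow_mul hD0.le, one_div_mul_cancel (by linarith), Real.rpow_one] at h5
    linarith

lemma exist {N : ℕ} {A : ℝ} (hA : 2 < A)
    {m : Fin N → ℝ} (hm : ∀ k, 0 < m k)
    {f : (Fin N → ℂ) → ℝ}
    (hf : ∀ q : Fin N → ℂ, (∀ k l, k ≠ l → q k ≠ q l) →
      f q = ((∑ k, m k) / 2) * ∑ k, m k * ‖q k‖ ^ 2 +
        (1 / (A - 2)) * ∑ k, ∑ l ∈ Finset.Ioi k, m k * m l * ‖q k - q l‖ ^ (2 - A)) :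
    ∃ x : Fin N → ℝ, StrictMono x ∧ fderiv ℝ f (fun k => (x k : ℂ)) = 0 := by
  set F : (Fin N → ℝ) → ℝ := fun x => f (fun k => (x k : ℂ)) with hF
  set x0 : Fin N → ℝ := fun k => (k.1 : ℝ) with hx0
  have hx0m : StrictMono x0 := fun a b h => by simpa [hx0] using h
  have hC : 0 ≤ F x0 := by
    have hA' : 0 < A - 2 := by linarith
    rw [hF]
    dsimp only
    rw [hf _ (ofReal_ne hx0m)]
    refine add_nonneg (mul_nonneg ?_ ?_) (mul_nonneg (by positivity) ?_)
    · exact div_nonneg (Finset.sum_nonneg fun k _ => (hm k).le) (by norm_num)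
    · exact Finset.sum_nonneg fun k _ => mul_nonneg (hm k).le (by positivity)
    · refine Finset.sum_nonneg fun k _ => Finset.sum_nonneg fun l _ => ?_
      have := hm k; have := hm l; positivity
  obtain ⟨R, δ, hδ, hK⟩ := bound_K hA hm (F x0) hC
  have hK' : ∀ x, StrictMono x → F x ≤ F x0 → (∀ k, |x k| ≤ R) ∧ ∀ k l, k < l → δ ≤ x l - x k := by
    intro x hx hle
    refine hK x hx ?_
    rw [← hf _ (ofReal_ne hx)]
    exact hle
  set K : Set (Fin N → ℝ) := {x | (∀ k, |x k| ≤ R) ∧ ∀ k l, k < l → δ ≤ x l - x k} with hKdef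
  have hKm : ∀ x ∈ K, StrictMono x := by
    intro x hx a b hab
    linarith [hx.2 a b hab]
  have hKc : IsCompact K := by
    have hsub : K ⊆ Set.Icc (fun _ => -R) (fun _ => R) := by
      intro x hx
      exact ⟨fun k => (abs_le.1 (hx.1 k)).1, fun k => (abs_le.1 (hx.1 k)).2⟩
    refine isCompact_Icc.of_isClosed_subset ?_ hsub
    rw [hKdef]
    simp only [Set.ofPred_and, Set.ofPred_forall]
    refine IsClosed.inter (isClosed_iInter fun k => isClosed_le (by fun_prop) (by fun_prop)) 
      (isClosed_iInter fun k => isClosed_iInter fun l => isClosed_iInter fun _ => isClosed_le (by fun_prop) (by fun_prop))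
  have hcont : ContinuousOn F K := by
    intro x hx
    refine ContinuousAt.continuousWithinAt ?_
    have h1 := (contDiffAt_f hf _ (ofReal_ne (hKm x hx))).2.continuousAt
    have h2 : Continuous (fun x : Fin N → ℝ => (fun k => (x k : ℂ))) := by fun_prop
    exact ContinuousAt.comp (f := fun x : Fin N → ℝ => (fun k => (x k : ℂ))) h1 h2.continuousAt
  obtain ⟨x, hxK, hxmin⟩ := hKc.exists_isMinOn ⟨x0, hK' x0 hx0m le_rfl⟩ hcont
  have hx := hKm x hxK
  have hmin : ∀ y, StrictMono y → F x ≤ F y := by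
    intro y hy
    by_cases h : F y ≤ F x0
    · exact hxmin (hK' y hy h)
    · exact (hxmin (hK' x0 hx0m le_rfl)).trans (not_le.1 h).le
  refine ⟨x, hx, ?_⟩
  ext v
  have hv : fderiv ℝ f (fun k => (x k : ℂ)) v = fderiv ℝ f (fun k => (x k : ℂ)) (fun k => ((v k).re : ℂ)) := by
    rw [fderiv_real' hA hf x hx, fderiv_real' hA hf x hx]
    simp
  rw [hv, zero_apply]
  set u : Fin N → ℝ := fun k => (v k).re with hu
  have hd := ((contDiffAt_f hf _ (ofReal_ne hx)).2.differentiableAt (by norm_num)).hasFDerivAt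
  have hl : HasDerivAt (fun s : ℝ => (fun k => ((x k + s * u k : ℝ) : ℂ))) (fun k => (u k : ℂ)) 0 := by
    rw [hasDerivAt_pi]
    intro k
    have : HasDerivAt (fun s : ℝ => x k + s * u k) (u k) 0 := by
      simpa using ((hasDerivAt_id (0:ℝ)).mul_const (u k)).const_add (x k)
    exact this.ofReal_comp
  have hd' : HasFDerivAt f (fderiv ℝ f (fun k => (x k : ℂ))) (fun k => ((x k + (0:ℝ) * u k : ℝ) : ℂ)) := by
    simpa using hd
  have h3 := hd'.comp_hasDerivAt (0:ℝ) hl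
  refine IsLocalMin.hasDerivAt_eq_zero ?_ h3
  have hopen : ∀ᶠ s : ℝ in nhds 0, ∀ k l : Fin N, k < l → x k + s * u k < x l + s * u l := by
    simp only [Filter.eventually_all]
    intro k l hkl
    have ho : IsOpen {s : ℝ | x k + s * u k < x l + s * u l} := isOpen_lt (by fun_prop) (by fun_prop)
    exact ho.mem_nhds (by simpa using hx hkl)
  filter_upwards [hopen] with s hs
  have := hmin (fun k => x k + s * u k) (fun k l h => hs k l h)
  simpa [hF] using this

lemma hess_real' {N : ℕ} {A : ℝ} (hA : 2 < A)
    {m : Fin N → ℝ} 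
    {f : (Fin N → ℂ) → ℝ}
    (hf : ∀ q : Fin N → ℂ, (∀ k l, k ≠ l → q k ≠ q l) →
      f q = ((∑ k, m k) / 2) * ∑ k, m k * ‖q k‖ ^ 2 +
        (1 / (A - 2)) * ∑ k, ∑ l ∈ Finset.Ioi k, m k * m l * ‖q k - q l‖ ^ (2 - A))
    (x : Fin N → ℝ) (hx : StrictMono x) (v : Fin N → ℂ) :
    fderiv ℝ (fderiv ℝ f) (fun k => (x k : ℂ)) v v = 
     ((∑ k, m k) * ∑ k, m k * (v k).re ^ 2 +
      ∑ k, ∑ l ∈ Finset.Ioi k, m k * m l * 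
        (|x k - x l| ^ (-A) * ((A - 1) * (v k - v l).re ^ 2))) + 
     ((∑ k, m k) * ∑ k, m k * (v k).im ^ 2 -
      ∑ k, m k * (v k).im * ∑ l, m l * (|x k - x l| ^ (-A) * ((v k).im - (v l).im))) := by
  rw [hess_real hA hf x hx v, ← form_eq m (fun k l => |x k - x l| ^ (-A)) (fun k l => by rw [abs_sub_comm]) (fun k => (v k).im)]
  have e1 : ∑ k, m k * ((v k).re ^ 2 + (v k).im ^ 2) = ∑ k, m k * (v k).re ^ 2 + ∑ k, m k * (v k).im ^ 2 := by
    rw [← Finset.sum_add_distrib]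
    exact Finset.sum_congr rfl fun k _ => by ring
  have e2 : ∑ k, ∑ l ∈ Finset.Ioi k, m k * m l * 
        (|x k - x l| ^ (-A) * ((1 - A) * (v k - v l).re ^ 2 + (v k - v l).im ^ 2)) = 
      ∑ k, ∑ l ∈ Finset.Ioi k, m k * m l * (|x k - x l| ^ (-A) * (((v k).im - (v l).im) * ((v k).im - (v l).im))) - 
      ∑ k, ∑ l ∈ Finset.Ioi k, m k * m l * 
        (|x k - x l| ^ (-A) * ((A - 1) * (v k - v l).re ^ 2)) := by
    simp only [← Finset.sum_sub_distrib]
    refine Finset.sum_congr rfl fun k _ => Finset.sum_congr rfl fun l _ => ?_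
    rw [Complex.sub_im]
    ring
  rw [e1, e2]
  ring

lemma index_eq {N : ℕ} (hN : 2 ≤ N) {A : ℝ} (hA : 2 < A)
    {m : Fin N → ℝ} (hm : ∀ k, 0 < m k)
    {f : (Fin N → ℂ) → ℝ}
    (hf : ∀ q : Fin N → ℂ, (∀ k l, k ≠ l → q k ≠ q l) →
      f q = ((∑ k, m k) / 2) * ∑ k, m k * ‖q k‖ ^ 2 +
        (1 / (A - 2)) * ∑ k, ∑ l ∈ Finset.Ioi k, m k * m l * ‖q k - q l‖ ^ (2 - A))
    (x : Fin N → ℝ) (hx : StrictMono x) (h : fderiv ℝ f (fun k => (x k : ℂ)) = 0) : 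
    morseIndex f (fun k => (x k : ℂ)) = N - 2 := by
  have hLx := crit_iff hA hm hf x hx h
  have hM : 0 < ∑ k, m k := Finset.sum_pos (fun k _ => hm k) ⟨⟨0, by omega⟩, mem_univ _⟩
  have hcm : ∑ k, m k * x k = 0 := by
    have := L_symm m (fun k l => |x k - x l| ^ (-A)) (fun k l => by rw [abs_sub_comm]) x (fun _ => 1)
    simp only [hLx] at this
    have h2 : ∑ k, m k * 1 * ((∑ k, m k) * x k) = (∑ k, m k) * ∑ k, m k * x k := by
      rw [Finset.mul_sum]; exact Finset.sum_congr rfl fun k _ => by ring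
    rw [h2] at this
    simp only [sub_self, mul_zero, Finset.sum_const_zero] at this
    exact (mul_eq_zero.1 this).resolve_left hM.ne'
  -- upper bound
  have hub : ∀ n ∈ {n : ℕ | ∃ V : Submodule ℝ (Fin N → ℂ), Module.finrank ℝ V = n ∧
    ∀ v ∈ V, v ≠ 0 → fderiv ℝ (fderiv ℝ f) (fun k => (x k : ℂ)) v v < 0}, n ≤ N - 2 := by
    rintro n ⟨V, hVn, hV⟩
    let Φ : ((Fin N → ℝ) × ℝ × ℝ) →ₗ[ℝ] (Fin N → ℂ) := 
      { toFun := fun p k => ⟨p.1 k, p.2.1 + p.2.2 * x k⟩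
        map_add' := by
          intro p q; ext k; apply Complex.ext <;> simp; ring
        map_smul' := by
          intro c p; ext k; apply Complex.ext <;> simp; ring }
    have hΦ : ∀ p k, Φ p k = ⟨p.1 k, p.2.1 + p.2.2 * x k⟩ := fun p k => rfl
    have hinj : Function.Injective Φ := by
      rw [injective_iff_map_eq_zero]
      rintro ⟨u, a, b⟩ hp
      have hk : ∀ k, u k = 0 ∧ a + b * x k = 0 := by
        intro k
        have := congrFun hp k
        rw [hΦ, Complex.ext_iff] at this
        simpa using this
      have h0 := (hk ⟨0, by omega⟩).2
      have h1 := (hk ⟨1, by omega⟩).2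
      have hlt : x ⟨0, by omega⟩ < x ⟨1, by omega⟩ := hx (by simp)
      have hb : b = 0 := by
        have : b * (x ⟨1, by omega⟩ - x ⟨0, by omega⟩) = 0 := by linarith
        exact (mul_eq_zero.1 this).resolve_right (by linarith)
      have ha : a = 0 := by rw [hb] at h0; linarith
      have hu : u = 0 := funext fun k => (hk k).1
      simp [ha, hb, hu]
    have hr : Module.finrank ℝ (LinearMap.range Φ) = N + 2 := by
      rw [LinearMap.finrank_range_of_inj hinj]
      simp
    have hdisj : Disjoint V (LinearMap.range Φ) := by
      rw [Submodule.disjoint_def]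
      rintro _ hv ⟨⟨u, a, b⟩, rfl⟩
      by_contra hne
      have hneg := hV _ hv hne
      rw [hess_real' hA hf x hx] at hneg
      simp only [hΦ] at hneg
      have p1 : 0 ≤ (∑ k, m k) * ∑ k, m k * u k ^ 2 := 
        mul_nonneg hM.le (Finset.sum_nonneg fun k _ => mul_nonneg (hm k).le (sq_nonneg _))
      have p2 : 0 ≤ ∑ k, ∑ l ∈ Finset.Ioi k, m k * m l * 
        (|x k - x l| ^ (-A) * ((A - 1) * ((⟨u k, a + b * x k⟩ : ℂ) - ⟨u l, a + b * x l⟩).re ^ 2)) := by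
        refine Finset.sum_nonneg fun k _ => Finset.sum_nonneg fun l _ => ?_
        have := hm k; have := hm l; have : 0 ≤ A - 1 := by linarith
        positivity
      have p3 : (∑ k, m k) * ∑ k, m k * (a + b * x k) ^ 2 -
        ∑ k, m k * (a + b * x k) * ∑ l, m l * (|x k - x l| ^ (-A) * ((a + b * x k) - (a + b * x l))) = 
        ((∑ k, m k) * a) ^ 2 := by
        have e1 : ∀ k, ∑ l, m l * (|x k - x l| ^ (-A) * ((a + b * x k) - (a + b * x l))) = b * ((∑ k, m k) * x k) := by
          intro k
          rw [← hLx, Finset.mul_sum]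
          exact Finset.sum_congr rfl fun l _ => by ring
        simp only [e1]
        have e2 : (∑ k, m k) * ∑ k, m k * (a + b * x k) ^ 2 - ∑ k, m k * (a + b * x k) * (b * ((∑ k, m k) * x k)) = 
          (∑ k, m k) * (a ^ 2 * ∑ k, m k + a * b * ∑ k, m k * x k) := by
          simp only [Finset.mul_sum (a := a^2), Finset.mul_sum (a := a * b)]
          rw [← Finset.sum_add_distrib, Finset.mul_sum, Finset.mul_sum, ← Finset.sum_sub_distrib]
          exact Finset.sum_congr rfl fun k _ => by ring
        rw [e2, hcm]; ring
      rw [p3] at hneg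
      have p4 := sq_nonneg ((∑ k, m k) * a)
      linarith
    have := Submodule.finrank_add_finrank_le_of_disjoint hdisj
    rw [hr, hVn] at this
    have h2N : Module.finrank ℝ (Fin N → ℂ) = 2 * N := by
      rw [Module.finrank_pi_fintype]
      simp [Complex.finrank_real_complex, mul_comm]
    omega
  -- lower bound
  have hlb : ∃ n ∈ {n : ℕ | ∃ V : Submodule ℝ (Fin N → ℂ), Module.finrank ℝ V = n ∧
    ∀ v ∈ V, v ≠ 0 → fderiv ℝ (fderiv ℝ f) (fun k => (x k : ℂ)) v v < 0}, N - 2 ≤ n := by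
    let Ψ : (Fin N → ℝ) →ₗ[ℝ] ℝ × ℝ := 
      { toFun := fun v => (∑ k, m k * v k, ∑ k, m k * x k * v k)
        map_add' := by
          intro p q
          simp [mul_add, Finset.sum_add_distrib]
        map_smul' := by
          intro c p
          simp only [Pi.smul_apply, smul_eq_mul, RingHom.id_apply, Prod.smul_mk, Finset.mul_sum, Prod.mk.injEq]
          constructor <;> exact Finset.sum_congr rfl fun k _ => by ring }
    let ι : (Fin N → ℝ) →ₗ[ℝ] (Fin N → ℂ) := 
      { toFun := fun v k => ⟨0, v k⟩
        map_add' := by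
          intro p q; ext k; apply Complex.ext <;> simp
        map_smul' := by
          intro c p; ext k; apply Complex.ext <;> simp }
    have hι : ∀ v k, ι v k = ⟨0, v k⟩ := fun v k => rfl
    have hinj : Function.Injective ι := by
      rw [injective_iff_map_eq_zero]
      intro v hv
      ext k
      have := congrFun hv k
      rw [hι, Complex.ext_iff] at this
      simpa using this
    refine ⟨_, ⟨(LinearMap.ker Ψ).map ι, rfl, ?_⟩, ?_⟩
    · rintro _ ⟨v, hv, rfl⟩ hne
      have hv' : (∑ k, m k * v k, ∑ k, m k * x k * v k) = ((0, 0) : ℝ × ℝ) := hv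
      rw [Prod.mk.injEq] at hv'
      have hv0 : v ≠ 0 := by
        rintro rfl
        exact hne (map_zero ι)
      have := neg_form hN A hA m hm (∑ k, m k) x v hx hLx hv0 hv'.1 hv'.2
      rw [hess_real' hA hf x hx]
      simp only [hι]
      simp only [Complex.sub_re, sub_self, ne_eq, OfNat.ofNat_ne_zero, not_false_eq_true, zero_pow, mul_zero, Finset.sum_const_zero, add_zero, zero_add]
      linarith
    · rw [← (Submodule.equivMapOfInjective ι hinj (LinearMap.ker Ψ)).finrank_eq]
      have h1 := LinearMap.finrank_range_add_finrank_ker Ψ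
      have h2 := Submodule.finrank_le (LinearMap.range Ψ)
      simp at h1 h2
      omega
  obtain ⟨n, hn, hn'⟩ := hlb
  unfold morseIndex
  exact le_antisymm (csSup_le ⟨n, hn⟩ hub) (hn'.trans (le_csSup ⟨_, hub⟩ hn))

/-- For `N ≥ 2`, `A > 2` and positive masses `m_1, …, m_N` with total mass `M`,
for each ordering there is exactly one collinear configuration `q_k = (x_k, 0)`,
`x_1 < ⋯ < x_N`, that is a critical point of
`f = (M/2)·∑ m_k‖q_k‖² + (1/(A-2))·∑_{k<l} m_k m_l ‖q_k - q_l‖^(2-A)`, and its planar Morse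
index is exactly `N - 2`. The plane `ℝ²` is modeled by `ℂ`, the line by the real axis. -/
theorem collinear_unique_and_index
    (N : ℕ) (hN : 2 ≤ N) (A : ℝ) (hA : 2 < A)
    (m : Fin N → ℝ) (hm : ∀ k, 0 < m k)
    (f : (Fin N → ℂ) → ℝ)
    (hf : ∀ q : Fin N → ℂ, (∀ k l, k ≠ l → q k ≠ q l) →
      f q = ((∑ k, m k) / 2) * ∑ k, m k * ‖q k‖ ^ 2 +
        (1 / (A - 2)) * ∑ k, ∑ l ∈ Finset.Ioi k, m k * m l * ‖q k - q l‖ ^ (2 - A)) :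
    (∃! x : Fin N → ℝ, StrictMono x ∧ fderiv ℝ f (fun k => (x k : ℂ)) = 0) ∧
      ∀ x : Fin N → ℝ, StrictMono x → fderiv ℝ f (fun k => (x k : ℂ)) = 0 →
        morseIndex f (fun k => (x k : ℂ)) = N - 2 := by
  refine ⟨?_, fun x hx h => index_eq hN hA hm hf x hx h⟩
  obtain ⟨x, hx, h⟩ := exist hA hm hf
  refine ⟨x, ⟨hx, h⟩, ?_⟩
  rintro y ⟨hy, h'⟩
  exact uniq hA hm y x hy hx (crit_iff hA hm hf y hy h') (crit_iff hA hm hf x hx h)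
end
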